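/- arXiv:2201.02496 — 3 statements merged into one kernel-verified Lean document; each statement's English description precedes it below -/
import Mathlib

section
/- Let ⊢ Γ be a classical 𝓛_C-sequent and x a propositional variable not occurring in Γ. Then ⊢ Γ is provable in LLW if and only if the intuitionistic sequent Γ^[x] ⊢ x is provable in ILLW. -/
namespace Affine

/-- Intuitionistic formulas: the language 𝓛 (⊗, ⊸, &, ⊕, !, 1, ⊤, ⊥, 0)
together with the extra ILAL modality §. -/
inductive IForm : Type where
  | var (n : ℕ)
  | one
  | top
  | bot
  | zero
  | tensor (A B : IForm)
  | limp (A B : IForm)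
  | and (A B : IForm)
  | or (A B : IForm)
  | bang (A : IForm)
  | para (A : IForm)

namespace IForm

/-- membership in the language 𝓛 (no §) -/
def inL : IForm → Prop
  | para _ => False
  | tensor A B => inL A ∧ inL B
  | limp A B => inL A ∧ inL B
  | and A B => inL A ∧ inL B
  | or A B => inL A ∧ inL B
  | bang A => inL A
  | _ => True

/-- membership in the ⊥-free language 𝓛⁺ -/
def inLp : IForm → Prop
  | para _ => False
  | bot => False
  | tensor A B => inLp A ∧ inLp B
  | limp A B => inLp A ∧ inLp B
  | and A B => inLp A ∧ inLp B
  | or A B => inLp A ∧ inLp B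
  | bang A => inLp A
  | _ => True

/-- {⊗,⊸,&,⊕,1,⊥}-formulas -/
def inFLei : IForm → Prop
  | var _ => True
  | one => True
  | bot => True
  | tensor A B => inFLei A ∧ inFLei B
  | limp A B => inFLei A ∧ inFLei B
  | and A B => inFLei A ∧ inFLei B
  | or A B => inFLei A ∧ inFLei B
  | _ => False

/-- {⊗,⊸,&,⊕,1}-formulas -/
def inFLeiP : IForm → Prop
  | var _ => True
  | one => True
  | tensor A B => inFLeiP A ∧ inFLeiP B
  | limp A B => inFLeiP A ∧ inFLeiP B
  | and A B => inFLeiP A ∧ inFLeiP B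
  | or A B => inFLeiP A ∧ inFLeiP B
  | _ => False

/-- purely implicational ({⊸}-) formulas -/
def inImp : IForm → Prop
  | var _ => True
  | limp A B => inImp A ∧ inImp B
  | _ => False

/-- {⊸,!}-formulas -/
def inImpBang : IForm → Prop
  | var _ => True
  | limp A B => inImpBang A ∧ inImpBang B
  | bang A => inImpBang A
  | _ => False

/-- {⊸,!,§}-formulas: the language of ILAL -/
def inLAL : IForm → Prop
  | var _ => True
  | limp A B => inLAL A ∧ inLAL B
  | bang A => inLAL A
  | para A => inLAL A
  | _ => False

end IForm

/-- A parametrized intuitionistic sequent calculus: `K` is the set of allowed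
formulas (the fragment), `ax` the set of non-logical axioms, and the remaining
fields tell which optional rules are available. -/
structure ICalc where
  K : IForm → Prop
  ax : Set IForm
  wL : Prop      -- unrestricted left weakening (W)
  wR : Prop      -- right weakening (W')
  bD : Prop      -- dereliction (!D)
  bP : Prop      -- promotion (!P)
  bF : Prop      -- functorial promotion (!F)
  bW : Prop      -- !-weakening (!W), for linear systems
  lB : Prop      -- the ILAL rule (!)
  lP : Prop      -- the ILAL rule (§)

/-- Provability of an intuitionistic sequent `Γ ⊢ X` (X a stoup) in the
parametrized calculus `C`. -/
inductive IPrv (C : ICalc) : Multiset IForm → Option IForm → Prop where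
  | axiom' {B} : B ∈ C.ax → IPrv C 0 (some B)
  | init {A} : C.K A → IPrv C {A} (some A)
  | oneR : C.K .one → IPrv C 0 (some .one)
  | botL : C.K .bot → IPrv C {.bot} none
  | topR {Γ} : C.K .top → (∀ A ∈ Γ, C.K A) → IPrv C Γ (some .top)
  | zeroL {Γ X} : C.K .zero → (∀ A ∈ Γ, C.K A) → (∀ A, X = some A → C.K A) →
      IPrv C (.zero ::ₘ Γ) X
  | cut {Γ Δ X A} : IPrv C Γ (some A) → IPrv C (A ::ₘ Δ) X → IPrv C (Γ + Δ) X
  | oneL {Γ X} : C.K .one → IPrv C Γ X → IPrv C (.one ::ₘ Γ) X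
  | botR {Γ} : C.K .bot → IPrv C Γ none → IPrv C Γ (some .bot)
  | limpL {Γ Δ X A B} : C.K (.limp A B) → IPrv C Γ (some A) → IPrv C (B ::ₘ Δ) X →
      IPrv C (.limp A B ::ₘ (Γ + Δ)) X
  | limpR {Γ A B} : C.K (.limp A B) → IPrv C (A ::ₘ Γ) (some B) →
      IPrv C Γ (some (.limp A B))
  | tensorL {Γ X A B} : C.K (.tensor A B) → IPrv C (A ::ₘ B ::ₘ Γ) X →
      IPrv C (.tensor A B ::ₘ Γ) X
  | tensorR {Γ Δ A B} : C.K (.tensor A B) → IPrv C Γ (some A) → IPrv C Δ (some B) →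
      IPrv C (Γ + Δ) (some (.tensor A B))
  | withL1 {Γ X A B} : C.K (.and A B) → IPrv C (A ::ₘ Γ) X → IPrv C (.and A B ::ₘ Γ) X
  | withL2 {Γ X A B} : C.K (.and A B) → IPrv C (B ::ₘ Γ) X → IPrv C (.and A B ::ₘ Γ) X
  | withR {Γ A B} : C.K (.and A B) → IPrv C Γ (some A) → IPrv C Γ (some B) →
      IPrv C Γ (some (.and A B))
  | plusL {Γ X A B} : C.K (.or A B) → IPrv C (A ::ₘ Γ) X → IPrv C (B ::ₘ Γ) X →
      IPrv C (.or A B ::ₘ Γ) X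
  | plusR1 {Γ A B} : C.K (.or A B) → IPrv C Γ (some A) → IPrv C Γ (some (.or A B))
  | plusR2 {Γ A B} : C.K (.or A B) → IPrv C Γ (some B) → IPrv C Γ (some (.or A B))
  | bangD {Γ X A} : C.bD → C.K (.bang A) → IPrv C (A ::ₘ Γ) X → IPrv C (.bang A ::ₘ Γ) X
  | bangP {Γ : Multiset IForm} {A} : C.bP → C.K (.bang A) → (∀ B ∈ Γ, C.K (.bang B)) →
      IPrv C (Γ.map .bang) (some A) → IPrv C (Γ.map .bang) (some (.bang A))
  | bangF {Γ : Multiset IForm} {A} : C.bF → C.K (.bang A) → (∀ B ∈ Γ, C.K (.bang B)) →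
      IPrv C Γ (some A) → IPrv C (Γ.map .bang) (some (.bang A))
  | weakL {Γ X A} : C.wL → C.K A → IPrv C Γ X → IPrv C (A ::ₘ Γ) X
  | bangW {Γ X A} : C.bW → C.K (.bang A) → IPrv C Γ X → IPrv C (.bang A ::ₘ Γ) X
  | bangC {Γ X A} : C.K (.bang A) → IPrv C (.bang A ::ₘ .bang A ::ₘ Γ) X →
      IPrv C (.bang A ::ₘ Γ) X
  | weakR {Γ A} : C.wR → C.K A → IPrv C Γ none → IPrv C Γ (some A)
  | lalBang {A} {E : Multiset IForm} : C.lB → C.K (.bang A) →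
      (∀ B ∈ E, C.K (.bang B)) → Multiset.card E ≤ 1 → IPrv C E (some A) →
      IPrv C (E.map .bang) (some (.bang A))
  | lalPara {Γ Δ : Multiset IForm} {A} : C.lP → C.K (.para A) → (∀ B ∈ Γ, C.K (.bang B)) →
      (∀ B ∈ Δ, C.K (.para B)) → IPrv C (Γ + Δ) (some A) →
      IPrv C (Γ.map .bang + Δ.map .para) (some (.para A))

/-- ILZW with a set of non-logical axioms. -/
def ILZWc (Φ : Set IForm) : ICalc :=
  ⟨IForm.inL, Φ, True, False, True, True, False, False, False, False⟩

/-- ILZW' = ILZW + right weakening, with a set of non-logical axioms. -/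
def ILZWpc (Φ : Set IForm) : ICalc :=
  ⟨IForm.inL, Φ, True, True, True, True, False, False, False, False⟩

/-- ILLW: the ⊥-free fragment of ILZW. -/
def ILLWc (Φ : Set IForm) : ICalc :=
  ⟨IForm.inLp, Φ, True, False, True, True, False, False, False, False⟩

/-- IEZW: intuitionistic elementary affine logic with bottom. -/
def IEZWc (Φ : Set IForm) : ICalc :=
  ⟨IForm.inL, Φ, True, False, False, False, True, False, False, False⟩

/-- IELW: the ⊥-free fragment of IEZW. -/
def IELWc (Φ : Set IForm) : ICalc :=
  ⟨IForm.inLp, Φ, True, False, False, False, True, False, False, False⟩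

/-- FLei: the {⊗,⊸,&,⊕,1,⊥}-fragment of ILZW. -/
def FLeic (Φ : Set IForm) : ICalc :=
  ⟨IForm.inFLei, Φ, True, False, True, True, False, False, False, False⟩

/-- FLew: the {⊗,⊸,&,⊕,1,⊥}-fragment of ILZW'. -/
def FLewc (Φ : Set IForm) : ICalc :=
  ⟨IForm.inFLei, Φ, True, True, True, True, False, False, False, False⟩

/-- FLei⁺: the {⊗,⊸,&,⊕,1}-fragment of ILZW. -/
def FLeiPc (Φ : Set IForm) : ICalc :=
  ⟨IForm.inFLeiP, Φ, True, False, True, True, False, False, False, False⟩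

/-- BCK: the {⊸}-fragment of ILZW. -/
def BCKc (Φ : Set IForm) : ICalc :=
  ⟨IForm.inImp, Φ, True, False, True, True, False, False, False, False⟩

/-- The {⊸,!}-fragment of ILLW. -/
def ImpBangILLWc (Φ : Set IForm) : ICalc :=
  ⟨IForm.inImpBang, Φ, True, False, True, True, False, False, False, False⟩

/-- ILL: intuitionistic linear logic (no unrestricted weakening, only !W). -/
def ILLc (Φ : Set IForm) : ICalc :=
  ⟨IForm.inLp, Φ, False, False, True, True, False, True, False, False⟩

/-- BCI: the {⊸}-fragment of ILL. -/
def BCIc (Φ : Set IForm) : ICalc :=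
  ⟨IForm.inImp, Φ, False, False, True, True, False, True, False, False⟩

/-- ILAL: intuitionistic light affine logic. -/
def ILALc (Φ : Set IForm) : ICalc :=
  ⟨IForm.inLAL, Φ, True, False, False, False, False, False, True, True⟩

/-- Classical formulas: literals p, p⊥ and the connectives ⊗, ⅋, &, ⊕, 1, ⊥, ⊤, 0, !, ?. -/
inductive CForm : Type where
  | pos (n : ℕ)
  | neg (n : ℕ)
  | one
  | bot
  | top
  | zero
  | tensor (A B : CForm)
  | par (A B : CForm)
  | and (A B : CForm)
  | or (A B : CForm)
  | bang (A : CForm)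
  | quest (A : CForm)

namespace CForm

/-- De Morgan (involutive) negation. -/
def dual : CForm → CForm
  | pos n => neg n
  | neg n => pos n
  | one => bot
  | bot => one
  | top => zero
  | zero => top
  | tensor A B => par A.dual B.dual
  | par A B => tensor A.dual B.dual
  | and A B => or A.dual B.dual
  | or A B => and A.dual B.dual
  | bang A => quest A.dual
  | quest A => bang A.dual

/-- the propositional variable `x` occurs in the formula -/
def hasVar (x : ℕ) : CForm → Prop
  | pos n => n = x
  | neg n => n = x
  | one => False
  | bot => False
  | top => False
  | zero => False
  | tensor A B => hasVar x A ∨ hasVar x B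
  | par A B => hasVar x A ∨ hasVar x B
  | and A B => hasVar x A ∨ hasVar x B
  | or A B => hasVar x A ∨ hasVar x B
  | bang A => hasVar x A
  | quest A => hasVar x A

/-- {⊗,⅋,&,⊕,1,⊥}-formulas (the language of InFLew) -/
def inMALL : CForm → Prop
  | pos _ => True
  | neg _ => True
  | one => True
  | bot => True
  | tensor A B => inMALL A ∧ inMALL B
  | par A B => inMALL A ∧ inMALL B
  | and A B => inMALL A ∧ inMALL B
  | or A B => inMALL A ∧ inMALL B
  | _ => False

end CForm

/-- A parametrized one-sided classical sequent calculus. -/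
structure CCalc where
  K : CForm → Prop
  ax : Set CForm
  wk : Prop      -- unrestricted weakening (W)
  der : Prop     -- dereliction (?)
  prom : Prop    -- promotion (!)
  funcF : Prop   -- the functorial rule (F) of ELLW
  qW : Prop      -- ?-weakening (?W), for LL

/-- Provability of a one-sided sequent `⊢ Γ` in the parametrized calculus `C`. -/
inductive CPrv (C : CCalc) : Multiset CForm → Prop where
  | axiom' {B} : B ∈ C.ax → CPrv C {B}
  | init {A} : C.K A → C.K A.dual → CPrv C {A, A.dual}
  | one : C.K .one → CPrv C {.one}
  | top {Γ} : C.K .top → (∀ A ∈ Γ, C.K A) → CPrv C (.top ::ₘ Γ)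
  | cut {Γ Δ A} : CPrv C (A ::ₘ Γ) → CPrv C (A.dual ::ₘ Δ) → CPrv C (Γ + Δ)
  | bot {Γ} : C.K .bot → CPrv C Γ → CPrv C (.bot ::ₘ Γ)
  | tensor {Γ Δ A B} : C.K (.tensor A B) → CPrv C (A ::ₘ Γ) → CPrv C (B ::ₘ Δ) →
      CPrv C (.tensor A B ::ₘ (Γ + Δ))
  | par {Γ A B} : C.K (.par A B) → CPrv C (A ::ₘ B ::ₘ Γ) → CPrv C (.par A B ::ₘ Γ)
  | with' {Γ A B} : C.K (.and A B) → CPrv C (A ::ₘ Γ) → CPrv C (B ::ₘ Γ) →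
      CPrv C (.and A B ::ₘ Γ)
  | plus1 {Γ A B} : C.K (.or A B) → CPrv C (A ::ₘ Γ) → CPrv C (.or A B ::ₘ Γ)
  | plus2 {Γ A B} : C.K (.or A B) → CPrv C (B ::ₘ Γ) → CPrv C (.or A B ::ₘ Γ)
  | der {Γ A} : C.der → C.K (.quest A) → CPrv C (A ::ₘ Γ) → CPrv C (.quest A ::ₘ Γ)
  | prom {Γ : Multiset CForm} {A} : C.prom → C.K (.bang A) → (∀ B ∈ Γ, C.K (.quest B)) →
      CPrv C (A ::ₘ Γ.map .quest) → CPrv C (.bang A ::ₘ Γ.map .quest)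
  | wk {Γ A} : C.wk → C.K A → CPrv C Γ → CPrv C (A ::ₘ Γ)
  | questW {Γ A} : C.qW → C.K (.quest A) → CPrv C Γ → CPrv C (.quest A ::ₘ Γ)
  | questC {Γ A} : C.K (.quest A) → CPrv C (.quest A ::ₘ .quest A ::ₘ Γ) →
      CPrv C (.quest A ::ₘ Γ)
  | funcF {Γ : Multiset CForm} {A} : C.funcF → C.K (.bang A) → (∀ B ∈ Γ, C.K (.quest B)) →
      CPrv C (A ::ₘ Γ) → CPrv C (.bang A ::ₘ Γ.map .quest)

/-- LLW: classical affine logic, with a set of non-logical axioms. -/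
def LLWc (Φ : Set CForm) : CCalc :=
  ⟨fun _ => True, Φ, True, True, True, False, False⟩

/-- ELLW: classical elementary affine logic. -/
def ELLWc (Φ : Set CForm) : CCalc :=
  ⟨fun _ => True, Φ, True, False, False, True, False⟩

/-- InFLew: the {⊗,⅋,&,⊕,1,⊥}-fragment of LLW. -/
def InFLewc (Φ : Set CForm) : CCalc :=
  ⟨CForm.inMALL, Φ, True, False, False, False, False⟩

/-- LL: classical linear logic (weakening restricted to ?W). -/
def LLc (Φ : Set CForm) : CCalc :=
  ⟨fun _ => True, Φ, False, True, True, False, True⟩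

/-- The translation (·)^[F] of classical formulas into intuitionistic formulas,
where ¬_F B := B ⊸ F. -/
def trF (F : IForm) : CForm → IForm
  | .pos n => .limp (.var n) F
  | .neg n => .var n
  | .one => .limp .one F
  | .bot => .one
  | .top => .zero
  | .zero => .limp .zero F
  | .tensor B C => .limp (.limp (trF F B) F) (trF F C)
  | .par B C => .limp (.limp (trF F B) (.limp (trF F C) F)) F
  | .and B C => .or (trF F B) (trF F C)
  | .or B C => .limp (.or (.limp (trF F B) F) (.limp (trF F C) F)) F
  | .bang B => .limp (.bang (.limp (trF F B) F)) F
  | .quest B => .bang (trF F B)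

/-- The embedding (·)̲ of ⊥-free intuitionistic formulas into classical formulas. -/
def emb : IForm → CForm
  | .var n => .pos n
  | .one => .one
  | .top => .top
  | .bot => .bot
  | .zero => .zero
  | .tensor A B => .tensor (emb A) (emb B)
  | .limp A B => .par (emb A).dual (emb B)
  | .and A B => .and (emb A) (emb B)
  | .or A B => .or (emb A) (emb B)
  | .bang A => .bang (emb A)
  | .para A => .bang (emb A)

end Affine

namespace Affine

/-! ### Cut elimination for LLW by phase semantics -/

/-- Closure of a set of classical sequents under the cut-free rules of LLW, with the initial
sequents restricted to literals. -/
structure CutFreeClosed (P : Multiset CForm → Prop) : Prop where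
  lit (n : ℕ) : P {.pos n, .neg n}
  one : P {.one}
  top (Γ) : P (.top ::ₘ Γ)
  bot {Γ} : P Γ → P (.bot ::ₘ Γ)
  tensor {Γ Δ A B} : P (A ::ₘ Γ) → P (B ::ₘ Δ) → P (.tensor A B ::ₘ (Γ + Δ))
  par {Γ A B} : P (A ::ₘ B ::ₘ Γ) → P (.par A B ::ₘ Γ)
  and {Γ A B} : P (A ::ₘ Γ) → P (B ::ₘ Γ) → P (.and A B ::ₘ Γ)
  or_left {Γ A B} : P (A ::ₘ Γ) → P (.or A B ::ₘ Γ)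
  or_right {Γ A B} : P (B ::ₘ Γ) → P (.or A B ::ₘ Γ)
  der {Γ A} : P (A ::ₘ Γ) → P (.quest A ::ₘ Γ)
  prom {Γ : Multiset CForm} {A} : P (A ::ₘ Γ.map .quest) → P (.bang A ::ₘ Γ.map .quest)
  wk {Γ A} : P Γ → P (A ::ₘ Γ)
  contr {Γ A} : P (.quest A ::ₘ .quest A ::ₘ Γ) → P (.quest A ::ₘ Γ)

namespace CForm

@[simp]
theorem dual_dual (A : CForm) : A.dual.dual = A := by
  induction A <;> simp_all [dual]

end CForm

namespace Phase

open scoped Pointwise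

variable (P : Multiset CForm → Prop)

/-- The orthogonal of a set of contexts with respect to the pole `P`. -/
def orth (X : Set (Multiset CForm)) : Set (Multiset CForm) :=
  {Δ | ∀ Θ ∈ X, P (Θ + Δ)}

/-- The contexts made of `?`-formulas only. -/
def questContexts : Set (Multiset CForm) :=
  Set.range (Multiset.map CForm.quest)

/-- The phase-semantic value of a classical formula. -/
def val : CForm → Set (Multiset CForm)
  | .pos n => orth P {{.pos n}}
  | .neg n => orth P (orth P {{.pos n}})
  | .one => orth P (orth P {0})
  | .bot => orth P {0}
  | .top => orth P (orth P Set.univ)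
  | .zero => orth P Set.univ
  | .tensor A B => orth P (orth P (val A + val B))
  | .par A B => orth P (orth P (val A) + orth P (val B))
  | .and A B => orth P (orth P (val A ∩ val B))
  | .or A B => orth P (orth P (val A) ∩ orth P (val B))
  | .bang A => orth P (orth P (val A ∩ questContexts))
  | .quest A => orth P (orth P (val A) ∩ questContexts)

/-- The sum of the values of the duals of the formulas of a sequent. -/
def dualSum (Γ : Multiset CForm) : Set (Multiset CForm) :=
  (Γ.map fun A => val P A.dual).sum

variable {P} {X Y : Set (Multiset CForm)}

theorem orth_anti (h : X ⊆ Y) : orth P Y ⊆ orth P X :=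
  fun _ hΔ Θ hΘ => hΔ Θ (h hΘ)

theorem subset_orth_comm : X ⊆ orth P Y ↔ Y ⊆ orth P X :=
  ⟨fun h y hy x hx => by rw [add_comm]; exact h hx y hy,
    fun h x hx y hy => by rw [add_comm]; exact h hy x hx⟩

theorem subset_orth_orth : X ⊆ orth P (orth P X) :=
  subset_orth_comm.1 subset_rfl

theorem orth_orth_subset (h : X ⊆ orth P Y) : orth P (orth P X) ⊆ orth P Y :=
  orth_anti (subset_orth_comm.1 h)

theorem orth_orth_orth : orth P (orth P (orth P X)) = orth P X :=
  (orth_orth_subset subset_rfl).antisymm subset_orth_orth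

theorem orth_orth_add : orth P (orth P X) + orth P (orth P Y) ⊆ orth P (orth P (X + Y)) := by
  rintro _ ⟨a, ha, b, hb, rfl⟩ Θ hΘ
  have h₁ : ∀ x ∈ X, Θ + x ∈ orth P Y := fun x hx y hy => by
    have := hΘ (x + y) (Set.add_mem_add hx hy)
    rwa [show y + (Θ + x) = x + y + Θ by abel]
  have h₂ : Θ + b ∈ orth P X := fun x hx => by
    have := hb _ (h₁ x hx)
    rwa [show x + (Θ + b) = Θ + x + b by abel]
  have := ha _ h₂
  rwa [show Θ + (a + b) = Θ + b + a by abel]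

theorem add_mem_questContexts {a b : Multiset CForm} (ha : a ∈ questContexts)
    (hb : b ∈ questContexts) : a + b ∈ questContexts := by
  obtain ⟨Γ, rfl⟩ := ha
  obtain ⟨Δ, rfl⟩ := hb
  exact ⟨Γ + Δ, Multiset.map_add _ _ _⟩

theorem exists_val_eq_orth (A : CForm) : ∃ X, val P A = orth P X := by
  cases A <;> exact ⟨_, rfl⟩

@[simp]
theorem orth_orth_val (A : CForm) : orth P (orth P (val P A)) = val P A := by
  obtain ⟨X, hX⟩ := exists_val_eq_orth (P := P) A
  rw [hX, orth_orth_orth]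

theorem val_dual (A : CForm) : val P A.dual = orth P (val P A) := by
  induction A <;> simp_all [CForm.dual, val, orth_orth_orth]

@[simp]
theorem dualSum_zero : dualSum P 0 = {0} := rfl

theorem dualSum_cons (A : CForm) (Γ : Multiset CForm) :
    dualSum P (A ::ₘ Γ) = orth P (val P A) + dualSum P Γ := by
  simp [dualSum, val_dual]

theorem dualSum_add (Γ Δ : Multiset CForm) :
    dualSum P (Γ + Δ) = dualSum P Γ + dualSum P Δ := by
  simp [dualSum]

theorem dualSum_cons_subset {A : CForm} {Γ : Multiset CForm} :
    dualSum P (A ::ₘ Γ) ⊆ {Δ | P Δ} ↔ dualSum P Γ ⊆ val P A := by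
  rw [dualSum_cons, Set.add_subset_iff]
  conv_rhs => rw [← orth_orth_val A]
  exact ⟨fun h b hb a ha => h a ha b hb, fun h a ha b hb => h hb a ha⟩

theorem exists_questContexts_generating (Γ : Multiset CForm) :
    ∃ T ⊆ questContexts, T ⊆ dualSum P (Γ.map .quest) ∧
      dualSum P (Γ.map .quest) ⊆ orth P (orth P T) := by
  induction Γ using Multiset.induction with
  | empty =>
    exact ⟨{0}, by rintro _ rfl; exact ⟨0, rfl⟩, subset_rfl, subset_orth_orth⟩
  | cons A Γ ih =>
    obtain ⟨T, hT, hT', hT''⟩ := ih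
    refine ⟨(orth P (val P A) ∩ questContexts) + T, ?_, ?_, ?_⟩
    · rintro _ ⟨a, ha, b, hb, rfl⟩
      exact add_mem_questContexts ha.2 (hT hb)
    · rw [Multiset.map_cons, dualSum_cons]
      exact Set.add_subset_add subset_orth_orth hT'
    · rw [Multiset.map_cons, dualSum_cons]
      exact (Set.add_subset_add subset_rfl hT'').trans orth_orth_add

end Phase

namespace CutFreeClosed

open Phase
open scoped Pointwise

variable {P : Multiset CForm → Prop}

theorem weaken (hP : CutFreeClosed P) {Γ : Multiset CForm} (Δ : Multiset CForm) (h : P Γ) :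
    P (Δ + Γ) := by
  induction Δ using Multiset.induction with
  | empty => simpa
  | cons A Δ ih => rw [Multiset.cons_add]; exact hP.wk ih

theorem contract (hP : CutFreeClosed P) (Γ : Multiset CForm) :
    ∀ {Δ : Multiset CForm}, P (Γ.map .quest + Γ.map .quest + Δ) → P (Γ.map .quest + Δ) := by
  induction Γ using Multiset.induction with
  | empty => simp
  | cons A Γ ih =>
    intro Δ h
    simp only [Multiset.map_cons, Multiset.cons_add, Multiset.add_cons] at h ⊢
    have := @ih (.quest A ::ₘ Δ) (by
      rw [Multiset.add_cons]
      exact hP.contr h)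
    rwa [Multiset.add_cons] at this

theorem val_subset (hP : CutFreeClosed P) (A : CForm) : val P A ⊆ orth P {{A}} := by
  induction A with
  | pos n => exact subset_rfl
  | neg n =>
    refine orth_anti (Set.singleton_subset_iff.2 ?_)
    rintro _ rfl
    exact hP.lit n
  | one =>
    refine orth_orth_subset ?_
    rintro _ rfl _ rfl
    exact hP.one
  | bot =>
    rintro Δ h _ rfl
    exact hP.bot (by simpa using h 0 rfl)
  | top =>
    refine orth_orth_subset ?_
    rintro Δ - _ rfl
    exact hP.top Δ
  | zero => exact orth_anti (Set.subset_univ _)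
  | tensor A B ihA ihB =>
    refine orth_orth_subset ?_
    rintro _ ⟨a, ha, b, hb, rfl⟩ _ rfl
    exact hP.tensor (ihA ha _ rfl) (ihB hb _ rfl)
  | par A B ihA ihB =>
    rintro Δ h _ rfl
    have := h _ (Set.add_mem_add (subset_orth_comm.1 ihA rfl) (subset_orth_comm.1 ihB rfl))
    exact hP.par (by rwa [add_assoc] at this)
  | and A B ihA ihB =>
    refine orth_orth_subset ?_
    rintro Δ ⟨ha, hb⟩ _ rfl
    exact hP.and (ihA ha _ rfl) (ihB hb _ rfl)
  | or A B ihA ihB =>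
    refine orth_anti (Set.singleton_subset_iff.2 ⟨fun Θ hΘ => ?_, fun Θ hΘ => ?_⟩)
    · rw [add_comm]
      exact hP.or_left (ihA hΘ _ rfl)
    · rw [add_comm]
      exact hP.or_right (ihB hΘ _ rfl)
  | bang A ih =>
    refine orth_orth_subset ?_
    rintro _ ⟨ha, Γ, rfl⟩ _ rfl
    exact hP.prom (ih ha _ rfl)
  | quest A ih =>
    refine orth_anti (Set.singleton_subset_iff.2 ⟨fun Θ hΘ => ?_, {A}, rfl⟩)
    rw [add_comm]
    exact hP.der (ih hΘ _ rfl)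

theorem mem_dualSum (hP : CutFreeClosed P) (Γ : Multiset CForm) : Γ ∈ dualSum P Γ := by
  induction Γ using Multiset.induction with
  | empty => simp
  | cons A Γ ih =>
    rw [dualSum_cons, ← Multiset.singleton_add]
    exact Set.add_mem_add (subset_orth_comm.1 (hP.val_subset A) rfl) ih

theorem dualSum_subset (hP : CutFreeClosed P) {Γ : Multiset CForm} (h : CPrv (LLWc ∅) Γ) :
    dualSum P Γ ⊆ {Δ | P Δ} := by
  induction h with
  | @init A _ _ =>
    refine dualSum_cons_subset.2 ?_
    rw [← Multiset.cons_zero, dualSum_cons, val_dual, orth_orth_val, dualSum_zero]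
    simp
  | one _ => exact dualSum_cons_subset.2 subset_orth_orth
  | top _ _ =>
    exact dualSum_cons_subset.2 ((Set.subset_univ _).trans subset_orth_orth)
  | @cut Γ Δ A _ _ ihA ihB =>
    rw [dualSum_cons_subset] at ihA ihB
    rw [dualSum_add, Set.add_subset_iff]
    intro a ha b hb
    rw [val_dual] at ihB
    exact ihB hb a (ihA ha)
  | bot _ _ ih =>
    refine dualSum_cons_subset.2 fun Δ hΔ => ?_
    rintro _ rfl
    simpa using ih hΔ
  | tensor _ _ _ ihA ihB =>
    rw [dualSum_cons_subset] at ihA ihB ⊢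
    rw [dualSum_add]
    exact (Set.add_subset_add ihA ihB).trans subset_orth_orth
  | par _ _ ih =>
    refine dualSum_cons_subset.2 fun Δ hΔ => ?_
    rw [dualSum_cons, dualSum_cons, ← add_assoc] at ih
    exact fun Θ hΘ => ih (Set.add_mem_add hΘ hΔ)
  | with' _ _ _ ihA ihB =>
    rw [dualSum_cons_subset] at ihA ihB ⊢
    exact (Set.subset_inter ihA ihB).trans subset_orth_orth
  | plus1 _ _ ih =>
    rw [dualSum_cons_subset] at ih ⊢
    rw [← orth_orth_val] at ih
    exact ih.trans (orth_anti Set.inter_subset_left)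
  | plus2 _ _ ih =>
    rw [dualSum_cons_subset] at ih ⊢
    rw [← orth_orth_val] at ih
    exact ih.trans (orth_anti Set.inter_subset_right)
  | der _ _ _ ih =>
    rw [dualSum_cons_subset] at ih ⊢
    rw [← orth_orth_val] at ih
    exact ih.trans (orth_anti Set.inter_subset_left)
  | @prom Γ A _ _ _ _ ih =>
    rw [dualSum_cons_subset] at ih ⊢
    obtain ⟨T, hT, hT', hT''⟩ := exists_questContexts_generating (P := P) Γ
    exact hT''.trans (orth_anti (orth_anti (Set.subset_inter (hT'.trans ih) hT)))
  | @wk Γ A _ _ _ ih =>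
    refine dualSum_cons_subset.2 fun Δ hΔ => ?_
    obtain ⟨X, hX⟩ := exists_val_eq_orth (P := P) A
    rw [hX]
    exact fun Θ _ => hP.weaken Θ (ih hΔ)
  | @questC Γ A _ _ ih =>
    refine dualSum_cons_subset.2 fun Δ hΔ Θ hΘ => ?_
    have hmem : Θ ∈ orth P (val P (.quest A)) := subset_orth_orth hΘ
    rw [dualSum_cons, dualSum_cons, ← add_assoc] at ih
    have h : P (Θ + Θ + Δ) := ih (Set.add_mem_add (Set.add_mem_add hmem hmem) hΔ)
    obtain ⟨-, Γ', rfl⟩ := hΘ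
    exact hP.contract Γ' h
  | _ => simp_all [LLWc]

/-- Cut elimination: LLW-provable sequents lie in every set closed under the cut-free rules. -/
theorem of_cprv (hP : CutFreeClosed P) {Γ : Multiset CForm} (h : CPrv (LLWc ∅) Γ) : P Γ :=
  hP.dualSum_subset h (hP.mem_dualSum Γ)

end CutFreeClosed

/-! ### From LLW to ILLW -/

theorem inLp_trF {F : IForm} (hF : F.inLp) (A : CForm) : (trF F A).inLp := by
  induction A <;> simp_all [trF, IForm.inLp]

section

variable {Γ Δ : Multiset IForm} {A B F : IForm}

theorem IPrv.neg_left (hA : A.inLp) (hF : F.inLp) (h : IPrv (ILLWc ∅) Γ (some A)) :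
    IPrv (ILLWc ∅) (.limp A F ::ₘ Γ) (some F) := by
  simpa using IPrv.limpL (C := ILLWc ∅) (Δ := 0) ⟨hA, hF⟩ h (IPrv.init hF)

theorem IPrv.neg_right (hA : A.inLp) (hF : F.inLp) (h : IPrv (ILLWc ∅) (A ::ₘ Γ) (some F)) :
    IPrv (ILLWc ∅) Γ (some (.limp A F)) :=
  IPrv.limpR (C := ILLWc ∅) ⟨hA, hF⟩ h

end

/-- The sequents whose translation is provable in ILLW are closed under the cut-free rules of
LLW. -/
theorem cutFreeClosed_translation (x : ℕ) : CutFreeClosed fun Γ =>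
    IPrv (ILLWc ∅) (Γ.map (trF (IForm.var x))) (some (IForm.var x)) := by
  have hx : (IForm.var x).inLp := trivial
  have hK : ∀ A, (trF (.var x) A).inLp := inLp_trF hx
  have hKs : ∀ (Γ : Multiset CForm), ∀ A ∈ Γ.map (trF (IForm.var x)), A.inLp := by
    intro Γ A hA
    obtain ⟨B, -, rfl⟩ := Multiset.mem_map.1 hA
    exact hK B
  constructor
  case lit =>
    intro n
    exact IPrv.neg_left (Γ := {_}) trivial hx (IPrv.init trivial)
  case one => exact IPrv.neg_left (Γ := 0) trivial hx (IPrv.oneR trivial)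
  case top =>
    intro Γ
    rw [Multiset.map_cons]
    exact IPrv.zeroL trivial (hKs Γ) (by rintro _ ⟨⟩; exact hx)
  case bot =>
    intro Γ h
    rw [Multiset.map_cons]
    exact IPrv.oneL trivial h
  case tensor =>
    intro Γ Δ A B hA hB
    simp only [Multiset.map_cons, Multiset.map_add] at *
    exact IPrv.limpL ⟨⟨hK A, hx⟩, hK B⟩ (IPrv.neg_right (hK A) hx hA) hB
  case par =>
    intro Γ A B h
    simp only [Multiset.map_cons] at *
    rw [Multiset.cons_swap] at h
    exact IPrv.neg_left ⟨hK A, hK B, hx⟩ hx (IPrv.limpR ⟨hK A, hK B, hx⟩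
      (IPrv.neg_right (hK B) hx h))
  case and =>
    intro Γ A B hA hB
    simp only [Multiset.map_cons] at *
    exact IPrv.plusL ⟨hK A, hK B⟩ hA hB
  case or_left =>
    intro Γ A B h
    simp only [Multiset.map_cons] at *
    exact IPrv.neg_left ⟨⟨hK A, hx⟩, hK B, hx⟩ hx
      (IPrv.plusR1 ⟨⟨hK A, hx⟩, hK B, hx⟩ (IPrv.neg_right (hK A) hx h))
  case or_right =>
    intro Γ A B h
    simp only [Multiset.map_cons] at *
    exact IPrv.neg_left ⟨⟨hK A, hx⟩, hK B, hx⟩ hx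
      (IPrv.plusR2 ⟨⟨hK A, hx⟩, hK B, hx⟩ (IPrv.neg_right (hK B) hx h))
  case der =>
    intro Γ A h
    simp only [Multiset.map_cons] at *
    exact IPrv.bangD trivial (hK A) h
  case prom =>
    intro Γ A h
    have hΓ : (Γ.map CForm.quest).map (trF (.var x)) = (Γ.map (trF (.var x))).map .bang := by
      rw [Multiset.map_map, Multiset.map_map]
      rfl
    simp only [Multiset.map_cons] at *
    rw [hΓ] at h ⊢
    exact IPrv.neg_left ⟨hK A, hx⟩ hx
      (IPrv.bangP trivial ⟨hK A, hx⟩ (hKs Γ) (IPrv.neg_right (hK A) hx h))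
  case wk =>
    intro Γ A h
    rw [Multiset.map_cons]
    exact IPrv.weakL trivial (hK A) h
  case contr =>
    intro Γ A h
    simp only [Multiset.map_cons] at *
    exact IPrv.bangC (hK A) h

/-! ### From ILLW to LLW -/

/-- The embedding of intuitionistic formulas into classical ones with `⊥` substituted for the
variable `x`. -/
def classicalAt (x : ℕ) : IForm → CForm
  | .var n => if n = x then .bot else .pos n
  | .one => .one
  | .top => .top
  | .bot => .bot
  | .zero => .zero
  | .tensor A B => .tensor (classicalAt x A) (classicalAt x B)
  | .limp A B => .par (classicalAt x A).dual (classicalAt x B)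
  | .and A B => .and (classicalAt x A) (classicalAt x B)
  | .or A B => .or (classicalAt x A) (classicalAt x B)
  | .bang A => .bang (classicalAt x A)
  | .para A => .bang (classicalAt x A)

/-- The classical context corresponding to a stoup. -/
def stoup (x : ℕ) : Option IForm → Multiset CForm
  | none => 0
  | some A => {classicalAt x A}

section

variable {Γ Δ : Multiset CForm} {A B C D : CForm}

theorem CPrv.identity (A : CForm) : CPrv (LLWc ∅) {A, A.dual} :=
  CPrv.init trivial trivial

theorem CPrv.swap (h : CPrv (LLWc ∅) {A, B}) : CPrv (LLWc ∅) {B, A} := by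
  rwa [Multiset.pair_comm]

theorem CPrv.identity' (A : CForm) : CPrv (LLWc ∅) {A.dual, A} :=
  (CPrv.identity A).swap

theorem cprv_of_iprv (x : ℕ) {Γ : Multiset IForm} {X : Option IForm}
    (h : IPrv (ILLWc ∅) Γ X) :
    CPrv (LLWc ∅) (Γ.map (fun A => (classicalAt x A).dual) + stoup x X) := by
  induction h with
  | init _ => exact CPrv.identity' _
  | oneR _ => exact CPrv.one trivial
  | topR _ _ =>
    rw [stoup, add_comm]
    exact CPrv.top trivial fun _ _ => trivial
  | zeroL _ _ _ =>
    rw [Multiset.map_cons, Multiset.cons_add]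
    exact CPrv.top trivial fun _ _ => trivial
  | cut _ _ ih₁ ih₂ =>
    rw [stoup, add_comm] at ih₁
    rw [Multiset.map_cons, Multiset.cons_add] at ih₂
    rw [Multiset.map_add, add_assoc]
    exact CPrv.cut ih₁ ih₂
  | oneL _ _ ih =>
    rw [Multiset.map_cons, Multiset.cons_add]
    exact CPrv.bot trivial ih
  | limpL _ _ _ ih₁ ih₂ =>
    rw [stoup, add_comm] at ih₁
    rw [Multiset.map_cons, Multiset.cons_add] at ih₂
    rw [Multiset.map_cons, Multiset.cons_add, Multiset.map_add, add_assoc]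
    simp only [classicalAt, CForm.dual, CForm.dual_dual]
    exact CPrv.tensor trivial ih₁ ih₂
  | limpR _ _ ih =>
    rw [Multiset.map_cons, Multiset.cons_add, stoup, add_comm] at ih
    rw [stoup, add_comm]
    exact CPrv.par trivial ih
  | tensorL _ _ ih =>
    simp only [Multiset.map_cons, Multiset.cons_add] at ih ⊢
    exact CPrv.par trivial ih
  | tensorR _ _ _ ih₁ ih₂ =>
    rw [stoup, add_comm] at ih₁ ih₂ ⊢
    rw [Multiset.map_add]
    exact CPrv.tensor trivial ih₁ ih₂
  | withL1 _ _ ih =>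
    simp only [Multiset.map_cons, Multiset.cons_add] at ih ⊢
    exact CPrv.plus1 trivial ih
  | withL2 _ _ ih =>
    simp only [Multiset.map_cons, Multiset.cons_add] at ih ⊢
    exact CPrv.plus2 trivial ih
  | withR _ _ _ ih₁ ih₂ =>
    rw [stoup, add_comm] at ih₁ ih₂ ⊢
    exact CPrv.with' trivial ih₁ ih₂
  | plusL _ _ _ ih₁ ih₂ =>
    simp only [Multiset.map_cons, Multiset.cons_add] at ih₁ ih₂ ⊢
    exact CPrv.with' trivial ih₁ ih₂
  | plusR1 _ _ ih =>
    rw [stoup, add_comm] at ih ⊢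
    exact CPrv.plus1 trivial ih
  | plusR2 _ _ ih =>
    rw [stoup, add_comm] at ih ⊢
    exact CPrv.plus2 trivial ih
  | bangD _ _ _ ih =>
    simp only [Multiset.map_cons, Multiset.cons_add] at ih ⊢
    exact CPrv.der trivial trivial ih
  | @bangP Γ A _ _ _ _ ih =>
    have hΓ : (Γ.map IForm.bang).map (fun B => (classicalAt x B).dual) =
        (Γ.map fun B => (classicalAt x B).dual).map .quest := by
      rw [Multiset.map_map, Multiset.map_map]
      rfl
    rw [hΓ, stoup, add_comm] at ih ⊢
    exact CPrv.prom trivial trivial (fun _ _ => trivial) ih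
  | weakL _ _ _ ih =>
    rw [Multiset.map_cons, Multiset.cons_add]
    exact CPrv.wk trivial trivial ih
  | bangC _ _ ih =>
    simp only [Multiset.map_cons, Multiset.cons_add] at ih ⊢
    exact CPrv.questC trivial ih
  | _ => simp_all [ILLWc, IForm.inLp]

/-- Provable equivalence of classical formulas in LLW. -/
def CEquiv (A B : CForm) : Prop :=
  CPrv (LLWc ∅) {A.dual, B} ∧ CPrv (LLWc ∅) {B.dual, A}

theorem CEquiv.refl (A : CForm) : CEquiv A A :=
  ⟨CPrv.identity' A, CPrv.identity' A⟩

theorem CEquiv.symm (h : CEquiv A B) : CEquiv B A :=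
  ⟨h.2, h.1⟩

theorem CPrv.of_equiv (h : CEquiv A B) (hA : CPrv (LLWc ∅) (A ::ₘ Γ)) :
    CPrv (LLWc ∅) (B ::ₘ Γ) := by
  have := CPrv.cut hA h.1
  rwa [add_comm, Multiset.singleton_add] at this

theorem CEquiv.trans (h₁ : CEquiv A B) (h₂ : CEquiv B C) : CEquiv A C := by
  have aux : ∀ {A B C}, CEquiv A B → CEquiv B C → CPrv (LLWc ∅) {A.dual, C} := by
    intro A B C h₁ h₂
    exact (CPrv.of_equiv (Γ := {A.dual}) h₂ h₁.1.swap).swap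
  exact ⟨aux h₁ h₂, aux h₂.symm h₁.symm⟩

theorem CEquiv.dual (h : CEquiv A B) : CEquiv A.dual B.dual := by
  constructor
  · rw [CForm.dual_dual]
    exact h.2.swap
  · rw [CForm.dual_dual]
    exact h.1.swap

theorem CEquiv.tensor (h₁ : CEquiv A B) (h₂ : CEquiv C D) :
    CEquiv (.tensor A C) (.tensor B D) := by
  have aux : ∀ {A B C D}, CEquiv A B → CEquiv C D →
      CPrv (LLWc ∅) {(CForm.tensor A C).dual, .tensor B D} := by
    intro A B C D h₁ h₂
    refine CPrv.par trivial ?_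
    have := CPrv.tensor (C := LLWc ∅) (Γ := {A.dual}) (Δ := {C.dual}) trivial
      h₁.1.swap h₂.1.swap
    convert this using 1
    simp only [← Multiset.singleton_add]
    abel
  exact ⟨aux h₁ h₂, aux h₁.symm h₂.symm⟩

theorem CEquiv.and (h₁ : CEquiv A B) (h₂ : CEquiv C D) : CEquiv (.and A C) (.and B D) := by
  have aux : ∀ {A B C D}, CEquiv A B → CEquiv C D →
      CPrv (LLWc ∅) {(CForm.and A C).dual, .and B D} := by
    intro A B C D h₁ h₂
    exact CPrv.swap (CPrv.with' (Γ := {_}) trivial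
      (CPrv.swap (CPrv.plus1 (Γ := {B}) trivial h₁.1))
      (CPrv.swap (CPrv.plus2 (Γ := {D}) trivial h₂.1)))
  exact ⟨aux h₁ h₂, aux h₁.symm h₂.symm⟩

theorem CEquiv.bang (h : CEquiv A B) : CEquiv (.bang A) (.bang B) := by
  have aux : ∀ {A B}, CEquiv A B → CPrv (LLWc ∅) {(CForm.bang A).dual, .bang B} := by
    intro A B h
    exact CPrv.swap (CPrv.prom (Γ := {A.dual}) trivial trivial (fun _ _ => trivial)
      (CPrv.swap (CPrv.der (Γ := {B}) trivial trivial h.1)))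
  exact ⟨aux h, aux h.symm⟩

theorem CEquiv.par (h₁ : CEquiv A B) (h₂ : CEquiv C D) : CEquiv (.par A C) (.par B D) := by
  simpa [CForm.dual] using (h₁.dual.tensor h₂.dual).dual

theorem CEquiv.or (h₁ : CEquiv A B) (h₂ : CEquiv C D) : CEquiv (.or A C) (.or B D) := by
  simpa [CForm.dual] using (h₁.dual.and h₂.dual).dual

theorem CEquiv.par_bot (A : CForm) : CEquiv (.par A .bot) A := by
  constructor
  · exact CPrv.tensor (Γ := {A}) (Δ := 0) trivial (CPrv.identity' A) (CPrv.one trivial)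
  · refine CPrv.swap (CPrv.par (Γ := {A.dual}) trivial ?_)
    rw [Multiset.cons_swap]
    exact CPrv.bot trivial (CPrv.identity A)

theorem cprv_map_of_equiv {ι : Type*} {f g : ι → CForm} (Γ : Multiset ι)
    (hfg : ∀ i ∈ Γ, CEquiv (f i) (g i)) (Δ : Multiset CForm)
    (h : CPrv (LLWc ∅) (Γ.map f + Δ)) : CPrv (LLWc ∅) (Γ.map g + Δ) := by
  induction Γ using Multiset.induction generalizing Δ with
  | empty => simpa using h
  | cons i Γ ih =>
    rw [Multiset.map_cons, Multiset.cons_add] at h ⊢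
    rw [← Multiset.add_cons]
    refine ih (fun j hj => hfg j (Multiset.mem_cons_of_mem hj)) _ ?_
    rw [Multiset.add_cons]
    exact CPrv.of_equiv (hfg i (Multiset.mem_cons_self i Γ)) h

end

/-- Reading `x` as `⊥`, the translation of a formula is its negation. -/
theorem classicalAt_trF {x : ℕ} {A : CForm} (hA : ¬ A.hasVar x) :
    CEquiv (classicalAt x (trF (.var x) A)) A.dual := by
  induction A with
  | pos n =>
    simp only [CForm.hasVar] at hA
    simpa [trF, classicalAt, hA] using CEquiv.par_bot _
  | neg n =>
    simp only [CForm.hasVar] at hA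
    simpa [trF, classicalAt, CForm.dual, hA] using CEquiv.refl _
  | one => simpa [trF, classicalAt] using CEquiv.par_bot _
  | bot => exact CEquiv.refl _
  | top => exact CEquiv.refl _
  | zero => simpa [trF, classicalAt] using CEquiv.par_bot _
  | tensor A B ihA ihB =>
    simp only [CForm.hasVar, not_or] at hA
    have h := ((CEquiv.par_bot _).trans (ihA hA.1).dual).dual.par (ihB hA.2)
    simpa [trF, classicalAt, CForm.dual] using h
  | par A B ihA ihB =>
    simp only [CForm.hasVar, not_or] at hA
    have h := (ihA hA.1).dual.par ((CEquiv.par_bot _).trans (ihB hA.2).dual)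
    simpa [trF, classicalAt, CForm.dual] using (CEquiv.par_bot _).trans h.dual
  | and A B ihA ihB =>
    simp only [CForm.hasVar, not_or] at hA
    exact (ihA hA.1).or (ihB hA.2)
  | or A B ihA ihB =>
    simp only [CForm.hasVar, not_or] at hA
    have h := ((CEquiv.par_bot _).trans (ihA hA.1).dual).or
      ((CEquiv.par_bot _).trans (ihB hA.2).dual)
    simpa [trF, classicalAt, CForm.dual] using (CEquiv.par_bot _).trans h.dual
  | bang A ih =>
    have h := ((CEquiv.par_bot _).trans (ih hA).dual).bang
    simpa [trF, classicalAt, CForm.dual] using (CEquiv.par_bot _).trans h.dual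
  | quest A ih => exact (ih hA).bang

/-- Theorem (Lazi\'c–Schmitz style translation, Theorem 2 (1)):
`⊢ Γ` is provable in LLW iff `Γ^[x] ⊢ x` is provable in ILLW,
for `x` a variable not occurring in `Γ`. -/
theorem llw_iff_illw_translation (Γ : Multiset CForm) (x : ℕ)
    (hx : ∀ A ∈ Γ, ¬ A.hasVar x) :
    CPrv (LLWc ∅) Γ ↔
      IPrv (ILLWc ∅) (Γ.map (trF (IForm.var x))) (some (IForm.var x)) := by
  refine ⟨fun h => (cutFreeClosed_translation x).of_cprv h, fun h => ?_⟩
  have h_sum := cprv_of_iprv x h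
  simp only [stoup, classicalAt, if_true, Multiset.map_map] at h_sum
  rw [add_comm, Multiset.singleton_add] at h_sum
  have h_cut := CPrv.cut (Δ := 0) h_sum (CPrv.one trivial)
  have h_dual := cprv_map_of_equiv (g := id) Γ (fun A hA => by
    simpa using (classicalAt_trF (hx A hA)).dual) 0 h_cut
  simpa using h_dual
end Affine
end

section
/- Let ⊢ Γ be a classical 𝓛_C-sequent and x a propositional variable not occurring in Γ. Then ⊢ Γ is provable in ELLW if and only if the intuitionistic sequent Γ^[x] ⊢ x is provable in IELW. -/
namespace Affine

section Intuitionistic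

variable {x : ℕ} {A B : IForm} {Γ Δ : Multiset IForm} {X : Option IForm}

/-- Intuitionistic negation relative to the variable `x`. -/
def IForm.neg (x : ℕ) (A : IForm) : IForm := .limp A (.var x)

/-- A translation of classical formulas such that `⊢ A` corresponds to `¬ (dneg x A) ⊢ x`
and `dneg x A.dual` behaves as the negation of `dneg x A`. -/
def dneg (x : ℕ) : CForm → IForm
  | .pos n => .var n
  | .neg n => .neg x (.var n)
  | .one => .one
  | .bot => .neg x .one
  | .zero => .zero
  | .top => .neg x .zero
  | .tensor B C => .tensor (dneg x B) (dneg x C)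
  | .par B C => .neg x (.tensor (.neg x (dneg x B)) (.neg x (dneg x C)))
  | .or B C => .or (dneg x B) (dneg x C)
  | .and B C => .neg x (.or (.neg x (dneg x B)) (.neg x (dneg x C)))
  | .bang B => .bang (.neg x (.neg x (dneg x B)))
  | .quest B => .neg x (.bang (.neg x (dneg x B)))

@[simp] lemma inLp_neg : (IForm.neg x A).inLp ↔ A.inLp := by
  simp [IForm.neg, IForm.inLp]

@[simp] lemma inLp_dneg (A : CForm) : (dneg x A).inLp := by
  induction A <;> simp_all [dneg, IForm.inLp]

@[simp] lemma inLp_trF_s1 (A : CForm) : (trF (.var x) A).inLp := by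
  induction A <;> simp_all [trF, IForm.inLp]

/-- Provability in IELW. -/
abbrev IELW (Γ : Multiset IForm) (X : Option IForm) : Prop := IPrv (IELWc ∅) Γ X

namespace IELW

lemma swap (h : IELW (A ::ₘ B ::ₘ Γ) X) : IELW (B ::ₘ A ::ₘ Γ) X := by
  rwa [Multiset.cons_swap]

lemma id (hA : A.inLp) : IELW {A} (some A) := IPrv.init hA

lemma weak (hA : A.inLp) (h : IELW Γ X) : IELW (A ::ₘ Γ) X := IPrv.weakL trivial hA h

lemma negR (hA : A.inLp) (h : IELW (A ::ₘ Γ) (some (.var x))) :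
    IELW Γ (some (.neg x A)) :=
  IPrv.limpR ⟨hA, trivial⟩ h

lemma negL (hA : A.inLp) (h : IELW Γ (some A)) :
    IELW (.neg x A ::ₘ Γ) (some (.var x)) := by
  simpa [IForm.neg] using IPrv.limpL (C := IELWc ∅) (Δ := 0) (B := .var x) ⟨hA, trivial⟩ h
    (IPrv.init trivial)

lemma negNegL (hA : A.inLp) (h : IELW (A ::ₘ Γ) (some (.var x))) :
    IELW (.neg x (.neg x A) ::ₘ Γ) (some (.var x)) :=
  negL (by simpa) (negR hA h)

lemma cutL (h : IELW {A} (some B)) (h' : IELW (B ::ₘ Γ) X) : IELW (A ::ₘ Γ) X := by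
  simpa using IPrv.cut h h'

lemma negNegR (hA : A.inLp) (h : IELW Γ (some A)) : IELW Γ (some (.neg x (.neg x A))) :=
  negR (by simpa) (negL hA h)

lemma neg_of_pair (hA : A.inLp) (h : IELW {A, B} (some (.var x))) :
    IELW {B} (some (.neg x A)) :=
  negR hA h

lemma bangF (hA : A.inLp) (hB : B.inLp) (h : IELW {B} (some A)) :
    IELW {.bang B} (some (.bang A)) := by
  simpa using IPrv.bangF (C := IELWc ∅) (Γ := {B}) trivial hA
    (by simpa [IELWc, IForm.inLp] using hB) h

lemma tensor_mono {A' B' : IForm} (hA : A.inLp) (hB : B.inLp) (hA' : A'.inLp) (hB' : B'.inLp)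
    (h : IELW {A} (some A')) (h' : IELW {B} (some B')) :
    IELW {.tensor A B} (some (.tensor A' B')) :=
  IPrv.tensorL (C := IELWc ∅) (Γ := 0) ⟨hA, hB⟩
    (IPrv.tensorR (C := IELWc ∅) ⟨hA', hB'⟩ h h')

lemma or_mono {A' B' : IForm} (hA : A.inLp) (hB : B.inLp) (hA' : A'.inLp) (hB' : B'.inLp)
    (h : IELW {A} (some A')) (h' : IELW {B} (some B')) :
    IELW {.or A B} (some (.or A' B')) :=
  IPrv.plusL (C := IELWc ∅) (Γ := 0) ⟨hA, hB⟩ (IPrv.plusR1 ⟨hA', hB'⟩ h)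
    (IPrv.plusR2 ⟨hA', hB'⟩ h')

lemma neg_neg_tensor (hA : A.inLp) (hB : B.inLp) (h : IELW Γ (some (.neg x (.neg x A))))
    (h' : IELW Δ (some (.neg x (.neg x B)))) :
    IELW (.neg x (.tensor A B) ::ₘ (Γ + Δ)) (some (.var x)) := by
  have hT : (IForm.tensor A B).inLp := ⟨hA, hB⟩
  have h0 : IELW (A ::ₘ B ::ₘ {.neg x (.tensor A B)}) (some (.var x)) := by
    have := negL (x := x) hT
      (IPrv.tensorR (C := IELWc ∅) hT (IPrv.init hA) (IPrv.init hB))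
    rw [← Multiset.singleton_add] at this
    rwa [← Multiset.singleton_add, ← Multiset.singleton_add B, ← add_assoc, add_comm]
  have h1 := negNegL hB (swap (negNegL hA h0))
  have h2 := IPrv.cut h' h1
  rw [Multiset.add_cons] at h2
  have h3 := IPrv.cut h h2
  rwa [← add_assoc, add_comm] at h3

end IELW

open IELW

/-- A negated formula refutes, and is refuted by, any formula interderivable with it
up to double negation. -/
lemma neg_complementary (hB : B.inLp) (h : IELW {A} (some B))
    (h' : IELW (.neg x A ::ₘ {B}) (some (.var x))) :
    IELW {A, .neg x B} (some (.var x)) ∧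
      IELW {.neg x A, .neg x (.neg x B)} (some (.var x)) :=
  ⟨swap (negL hB h), swap (negNegL hB (swap h'))⟩

lemma dneg_complementary (A : CForm) :
    IELW {dneg x A, dneg x A.dual} (some (.var x)) ∧
      IELW {.neg x (dneg x A), .neg x (dneg x A.dual)} (some (.var x)) := by
  have symm : ∀ {A B : IForm}, (IELW {A, .neg x B} (some (.var x)) ∧
      IELW {.neg x A, .neg x (.neg x B)} (some (.var x))) →
      (IELW {.neg x B, A} (some (.var x)) ∧
      IELW {.neg x (.neg x B), .neg x A} (some (.var x))) :=
    fun h => ⟨swap h.1, swap h.2⟩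
  have refl : ∀ {A : IForm}, A.inLp → (IELW {A, .neg x A} (some (.var x)) ∧
      IELW {.neg x A, .neg x (.neg x A)} (some (.var x))) :=
    fun h => neg_complementary h (IELW.id h) (negL h (IELW.id h))
  have tensor : ∀ {A B A' B' : IForm}, A.inLp → B.inLp → A'.inLp → B'.inLp →
      (IELW {A, A'} (some (.var x)) ∧ IELW {.neg x A, .neg x A'} (some (.var x))) →
      (IELW {B, B'} (some (.var x)) ∧ IELW {.neg x B, .neg x B'} (some (.var x))) →
      (IELW {.tensor A B, .neg x (.tensor (.neg x A') (.neg x B'))} (some (.var x)) ∧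
        IELW {.neg x (.tensor A B), .neg x (.neg x (.tensor (.neg x A') (.neg x B')))}
          (some (.var x))) := by
    intro A B A' B' hA hB hA' hB' h h'
    refine neg_complementary (by simp [IForm.inLp, *])
      (tensor_mono hA hB (by simpa) (by simpa) (neg_of_pair hA' (swap h.1))
        (neg_of_pair hB' (swap h'.1))) ?_
    refine swap (IPrv.tensorL (by simp [IELWc, IForm.inLp, *]) ?_)
    have := neg_neg_tensor hA hB (neg_of_pair (by simpa) h.2) (neg_of_pair (by simpa) h'.2)
    rw [← Multiset.singleton_add] at this
    rwa [← Multiset.singleton_add, ← Multiset.singleton_add (IForm.neg x B'), ← add_assoc,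
      add_comm]
  have or : ∀ {A B A' B' : IForm}, A.inLp → B.inLp → A'.inLp → B'.inLp →
      (IELW {A, A'} (some (.var x)) ∧ IELW {.neg x A, .neg x A'} (some (.var x))) →
      (IELW {B, B'} (some (.var x)) ∧ IELW {.neg x B, .neg x B'} (some (.var x))) →
      (IELW {.or A B, .neg x (.or (.neg x A') (.neg x B'))} (some (.var x)) ∧
        IELW {.neg x (.or A B), .neg x (.neg x (.or (.neg x A') (.neg x B')))}
          (some (.var x))) := by
    intro A B A' B' hA hB hA' hB' h h'
    have hO : (IForm.or A B).inLp := ⟨hA, hB⟩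
    refine neg_complementary (by simp [IForm.inLp, *])
      (or_mono hA hB (by simpa) (by simpa) (neg_of_pair hA' (swap h.1))
        (neg_of_pair hB' (swap h'.1))) ?_
    refine swap (IPrv.plusL (by simp [IELWc, IForm.inLp, *]) ?_ ?_)
    · exact swap (cutL (neg_of_pair hA (swap (negL hO (IPrv.plusR1 hO (IELW.id hA))))) h.2)
    · exact swap (cutL (neg_of_pair hB (swap (negL hO (IPrv.plusR2 hO (IELW.id hB))))) h'.2)
  have bang : ∀ {A A' : IForm}, A.inLp → A'.inLp →
      (IELW {A, A'} (some (.var x)) ∧ IELW {.neg x A, .neg x A'} (some (.var x))) →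
      (IELW {.bang (.neg x (.neg x A)), .neg x (.bang (.neg x A'))} (some (.var x)) ∧
        IELW {.neg x (.bang (.neg x (.neg x A))), .neg x (.neg x (.bang (.neg x A')))}
          (some (.var x))) := by
    intro A A' hA hA' h
    refine neg_complementary (by simpa [IForm.inLp])
      (bangF (by simpa) (by simpa) (neg_of_pair hA' (swap (negNegL hA h.1)))) ?_
    exact negL (by simpa [IForm.inLp])
      (bangF (by simpa) (by simpa) (neg_of_pair (by simpa) h.2))
  induction A with
  | pos n => exact refl (A := .var n) trivial
  | neg n => exact symm (refl (A := .var n) trivial)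
  | one => exact refl (A := .one) trivial
  | bot => exact symm (refl (A := .one) trivial)
  | zero => exact refl (A := .zero) trivial
  | top => exact symm (refl (A := .zero) trivial)
  | tensor B C hB hC => exact tensor (by simp) (by simp) (by simp) (by simp) hB hC
  | par B C hB hC =>
    exact symm (tensor (by simp) (by simp) (by simp) (by simp) ⟨swap hB.1, swap hB.2⟩
      ⟨swap hC.1, swap hC.2⟩)
  | or B C hB hC => exact or (by simp) (by simp) (by simp) (by simp) hB hC
  | and B C hB hC =>
    exact symm (or (by simp) (by simp) (by simp) (by simp) ⟨swap hB.1, swap hB.2⟩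
      ⟨swap hC.1, swap hC.2⟩)
  | bang B hB => exact bang (by simp) (by simp) hB
  | quest B hB => exact symm (bang (by simp) (by simp) ⟨swap hB.1, swap hB.2⟩)

lemma neg_neg_map {ι : Type*} (f : ι → IForm) (hf : ∀ i, (f i).inLp) (S : Multiset ι)
    (h : IELW (S.map f + Γ) (some (.var x))) :
    IELW (S.map (fun i => .neg x (.neg x (f i))) + Γ) (some (.var x)) := by
  induction S using Multiset.induction_on generalizing Γ with
  | empty => simpa using h
  | cons i S ih =>
    rw [Multiset.map_cons, Multiset.cons_add] at h ⊢
    have := ih (Γ := .neg x (.neg x (f i)) ::ₘ Γ)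
    rw [Multiset.add_cons, Multiset.add_cons] at this
    exact this (negNegL (hf i) h)

/-- Soundness of ELLW under the translation `A ↦ ¬ (dneg x A)`. -/
lemma dneg_sound {Γ : Multiset CForm} (h : CPrv (ELLWc ∅) Γ) :
    IELW (Γ.map (fun A => .neg x (dneg x A))) (some (.var x)) := by
  induction h with
  | axiom' h => exact h.elim
  | init => exact (dneg_complementary _).2
  | one => exact negL (A := .one) trivial (IPrv.oneR trivial)
  | @top Γ =>
    rw [Multiset.map_cons]
    exact negNegL (A := .zero) trivial
      (IPrv.zeroL trivial (by simp [IELWc]) (by rintro _ ⟨⟩; trivial))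
  | @cut Γ Δ A _ _ h h' =>
    rw [Multiset.map_cons] at h h'
    have h1 := negR (by simp) h
    have h2 := negR (by simp) h'
    have h3 : IELW {.neg x (.neg x (dneg x A)), .neg x (.neg x (dneg x A.dual))}
        (some (.var x)) :=
      negNegL (by simp) (swap (negNegL (by simp) (swap (dneg_complementary A).1)))
    have h4 := IPrv.cut h2 (swap (Γ := 0) h3)
    rw [Multiset.add_cons] at h4
    rw [Multiset.map_add]
    simpa using IPrv.cut h1 h4
  | bot _ _ h =>
    rw [Multiset.map_cons]
    exact negNegL (A := .one) trivial (IPrv.oneL trivial h)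
  | tensor _ _ _ h h' =>
    rw [Multiset.map_cons] at h h' ⊢
    rw [Multiset.map_add]
    exact neg_neg_tensor (by simp) (by simp) (negR (by simp) h) (negR (by simp) h')
  | par _ _ h =>
    rw [Multiset.map_cons, Multiset.map_cons] at h
    rw [Multiset.map_cons]
    exact negNegL (by simp [IForm.inLp]) (IPrv.tensorL (by simp [IForm.inLp, IELWc]) h)
  | with' _ _ _ h h' =>
    rw [Multiset.map_cons] at h h' ⊢
    exact negNegL (by simp [IForm.inLp]) (IPrv.plusL (by simp [IForm.inLp, IELWc]) h h')
  | plus1 _ _ h =>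
    rw [Multiset.map_cons] at h ⊢
    refine cutL (neg_of_pair (by simp) (swap (negL (by simp) ?_))) h
    exact IPrv.plusR1 (by simp [IForm.inLp, IELWc]) (IELW.id (by simp))
  | plus2 _ _ h =>
    rw [Multiset.map_cons] at h ⊢
    refine cutL (neg_of_pair (by simp) (swap (negL (by simp) ?_))) h
    exact IPrv.plusR2 (by simp [IForm.inLp, IELWc]) (IELW.id (by simp))
  | der h => exact h.elim
  | prom h => exact h.elim
  | wk _ _ _ h =>
    rw [Multiset.map_cons]
    exact weak (by simp) h
  | questW h => exact h.elim
  | @questC Γ A _ _ h =>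
    rw [Multiset.map_cons, Multiset.map_cons] at h
    rw [Multiset.map_cons]
    have hk : (IForm.bang (.neg x (dneg x A))).inLp := by simp [IForm.inLp]
    have hid := negNegR (x := x) hk (IELW.id hk)
    exact negNegL hk (IPrv.bangC hk (cutL hid (swap (cutL hid h))))
  | @funcF Γ A _ _ _ _ h =>
    rw [Multiset.map_cons] at h ⊢
    have h1 := IPrv.bangF (C := IELWc ∅) trivial (by simp [IForm.inLp, IELWc])
      (by simp [IForm.inLp, IELWc]) (negR (by simp) h)
    have h2 := negL (x := x) (by simp [IForm.inLp]) h1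
    rw [Multiset.map_map, ← Multiset.singleton_add, add_comm] at h2
    have h3 := neg_neg_map _ (by simp [IForm.inLp]) _ h2
    rw [add_comm, Multiset.singleton_add] at h3
    rwa [Multiset.map_map]

lemma trF_refutes_dneg (A : CForm) :
    IELW {trF (.var x) A, dneg x A} (some (.var x)) := by
  have hid : ∀ {A : IForm}, A.inLp → IELW {.neg x A, A} (some (.var x)) :=
    fun h => negL h (IELW.id h)
  induction A with
  | pos n => exact hid (A := .var n) trivial
  | neg n => exact swap (hid (A := .var n) trivial)
  | one => exact hid (A := .one) trivial
  | bot => exact swap (hid (A := .one) trivial)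
  | zero => exact hid (A := .zero) trivial
  | top => exact swap (hid (A := .zero) trivial)
  | tensor B C hB hC =>
    refine swap (IPrv.tensorL (by simp [IForm.inLp, IELWc]) ?_)
    have := IPrv.limpL (C := IELWc ∅) (by simp [IForm.inLp, IELWc])
      (neg_of_pair (by simp) hB) hC
    rw [← Multiset.singleton_add] at this
    rwa [← Multiset.singleton_add, ← Multiset.singleton_add (dneg x C), ← add_assoc, add_comm]
  | par B C hB hC =>
    have hT : (IForm.tensor (.neg x (dneg x B)) (.neg x (dneg x C))).inLp := by
      simp [IForm.inLp]
    refine negL (by simp [IForm.inLp]) (IPrv.limpR (by simp [IForm.inLp, IELWc])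
      (IPrv.limpR (by simp [IForm.inLp, IELWc]) ?_))
    have := negL (x := x) hT (IPrv.tensorR (C := IELWc ∅) hT
      (neg_of_pair (by simp) (swap hB))
      (neg_of_pair (by simp) (swap hC)))
    rw [← Multiset.singleton_add] at this
    rw [← Multiset.singleton_add, ← Multiset.singleton_add (trF _ B), ← add_assoc, add_comm,
      add_comm {trF _ C}]
    exact this
  | and B C hB hC =>
    refine swap (negL (by simp [IForm.inLp]) (or_mono ?_ ?_ ?_ ?_
      (neg_of_pair ?_ (swap hB)) (neg_of_pair ?_ (swap hC)))) <;> simp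
  | or B C hB hC =>
    refine negL (A := .or (.neg x _) (.neg x _)) (by simp [IForm.inLp]) (or_mono ?_ ?_ ?_ ?_
      (neg_of_pair ?_ hB) (neg_of_pair ?_ hC)) <;> simp
  | bang B hB =>
    refine negL (A := .bang (.neg x _)) (by simp [IForm.inLp]) (bangF ?_ ?_
      (neg_of_pair ?_ (swap (negNegL ?_ (swap hB))))) <;> simp
  | quest B hB =>
    refine swap (negL (by simp [IForm.inLp]) (bangF ?_ ?_
      (neg_of_pair ?_ (swap hB)))) <;> simp

lemma cut_map {ι : Type*} (f g : ι → IForm) (S : Multiset ι)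
    (hfg : ∀ i, IELW {f i} (some (g i))) (h : IELW (S.map g + Γ) X) :
    IELW (S.map f + Γ) X := by
  induction S using Multiset.induction_on generalizing Γ with
  | empty => simpa using h
  | cons i S ih =>
    rw [Multiset.map_cons, Multiset.cons_add] at h ⊢
    have := ih (Γ := f i ::ₘ Γ)
    rw [Multiset.add_cons, Multiset.add_cons] at this
    exact this (cutL (hfg i) h)

end Intuitionistic

section Classical

variable {x : ℕ} {A B : CForm} {Γ Δ : Multiset CForm}

@[simp] lemma CForm.dual_dual_s1 (A : CForm) : A.dual.dual = A := by
  induction A <;> simp_all [CForm.dual]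

/-- The embedding of intuitionistic into classical formulas sending `x` to `⊥`. -/
def embBot (x : ℕ) : IForm → CForm
  | .var n => if n = x then .bot else .pos n
  | .one => .one
  | .zero => .zero
  | .top => .top
  | .bot => .bot
  | .tensor A B => .tensor (embBot x A) (embBot x B)
  | .limp A B => .par (embBot x A).dual (embBot x B)
  | .and A B => .and (embBot x A) (embBot x B)
  | .or A B => .or (embBot x A) (embBot x B)
  | .bang A => .bang (embBot x A)
  | .para A => .bang (embBot x A)

/-- Provability in ELLW. -/
abbrev ELLW (Γ : Multiset CForm) : Prop := CPrv (ELLWc ∅) Γ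

namespace ELLW

lemma swap (h : ELLW (A ::ₘ B ::ₘ Γ)) : ELLW (B ::ₘ A ::ₘ Γ) := by
  rwa [Multiset.cons_swap]

lemma tensor (h : ELLW (A ::ₘ Γ)) (h' : ELLW (B ::ₘ Δ)) :
    ELLW (.tensor A B ::ₘ (Γ + Δ)) := CPrv.tensor trivial h h'

lemma tensor_one (h : ELLW (A ::ₘ Γ)) : ELLW (.tensor A .one ::ₘ Γ) := by
  simpa using tensor (Δ := 0) h (CPrv.one (C := ELLWc ∅) trivial)

lemma par (h : ELLW (A ::ₘ B ::ₘ Γ)) : ELLW (.par A B ::ₘ Γ) := CPrv.par trivial h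

lemma par_bot (h : ELLW (A ::ₘ Γ)) : ELLW (.par A .bot ::ₘ Γ) :=
  par (swap (CPrv.bot trivial h))

lemma funcF (h : ELLW {A, B}) : ELLW {.bang A, .quest B} := by
  simpa using CPrv.funcF (C := ELLWc ∅) (Γ := {B}) trivial trivial (by simp [ELLWc]) h

end ELLW

open ELLW

/-- The classical antecedent of an intuitionistic one. -/
abbrev embL (x : ℕ) (Γ : Multiset IForm) : Multiset CForm :=
  Γ.map (fun A => (embBot x A).dual)

/-- Soundness of IELW under the embedding `embBot x`. -/
lemma embBot_sound {Γ : Multiset IForm} {X : Option IForm} (h : IPrv (IELWc ∅) Γ X) :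
    ELLW (X.elim 0 (fun A => {embBot x A}) + embL x Γ) := by
  induction h with
  | axiom' h => exact h.elim
  | @init A _ => exact CPrv.init (C := ELLWc ∅) (A := embBot x A) trivial trivial
  | oneR => exact CPrv.one trivial
  | botL h => exact h.elim
  | topR => exact CPrv.top trivial (by simp [ELLWc])
  | zeroL =>
    simp only [embL, Multiset.map_cons, Multiset.add_cons]
    exact CPrv.top trivial (by simp [ELLWc])
  | @cut Γ Δ X A _ _ h h' =>
    simp only [embL, Multiset.map_cons, Multiset.add_cons, Multiset.map_add] at *
    have := CPrv.cut (C := ELLWc ∅) h h'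
    rwa [add_left_comm] at this
  | oneL _ _ h =>
    simp only [embL, Multiset.map_cons, Multiset.add_cons] at *
    exact CPrv.bot trivial h
  | botR h => exact h.elim
  | limpL _ _ _ h h' =>
    simp only [embL, Multiset.map_cons, Multiset.add_cons, Multiset.map_add] at *
    have := tensor h h'
    rw [add_left_comm] at this
    simpa [embBot, CForm.dual] using this
  | limpR _ _ h =>
    simp only [embL, Multiset.map_cons, Multiset.add_cons] at *
    exact par h
  | tensorL _ _ h =>
    simp only [embL, Multiset.map_cons, Multiset.add_cons] at *
    exact par h
  | tensorR _ _ _ h h' =>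
    simp only [embL, Multiset.map_add] at *
    have := tensor h h'
    simpa [embBot] using this
  | withL1 _ _ h =>
    simp only [embL, Multiset.map_cons, Multiset.add_cons] at *
    exact CPrv.plus1 trivial h
  | withL2 _ _ h =>
    simp only [embL, Multiset.map_cons, Multiset.add_cons] at *
    exact CPrv.plus2 trivial h
  | withR _ _ _ h h' => exact CPrv.with' trivial h h'
  | plusL _ _ _ h h' =>
    simp only [embL, Multiset.map_cons, Multiset.add_cons] at *
    exact CPrv.with' trivial h h'
  | plusR1 _ _ h => exact CPrv.plus1 trivial h
  | plusR2 _ _ h => exact CPrv.plus2 trivial h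
  | bangD h => exact h.elim
  | bangP h => exact h.elim
  | bangF _ _ _ _ h =>
    have := CPrv.funcF (C := ELLWc ∅) trivial trivial (by simp [ELLWc]) h
    rw [Multiset.map_map] at this
    rw [embL, Multiset.map_map]
    exact this
  | weakL _ _ _ h =>
    simp only [embL, Multiset.map_cons, Multiset.add_cons] at *
    exact CPrv.wk trivial trivial h
  | bangW h => exact h.elim
  | bangC _ _ h =>
    simp only [embL, Multiset.map_cons, Multiset.add_cons] at *
    exact CPrv.questC trivial h
  | weakR h => exact h.elim
  | lalBang h => exact h.elim
  | lalPara h => exact h.elim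

lemma embBot_trF (A : CForm) (hA : ¬ A.hasVar x) :
    ELLW {embBot x (trF (.var x) A), A} := by
  induction A with
  | pos n =>
    have hn : n ≠ x := hA
    simpa [trF, embBot, hn, CForm.dual] using
      par_bot (swap (CPrv.init (C := ELLWc ∅) (A := .pos n) (by trivial) (by trivial)))
  | neg n =>
    have hn : n ≠ x := hA
    simpa [trF, embBot, hn, CForm.dual] using
      CPrv.init (C := ELLWc ∅) (A := .pos n) trivial trivial
  | one =>
    simpa [trF, embBot, CForm.dual] using
      par_bot (swap (CPrv.init (C := ELLWc ∅) (A := .one) (by trivial) (by trivial)))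
  | bot => exact CPrv.init (A := .one) trivial trivial
  | zero =>
    simpa [trF, embBot, CForm.dual] using
      par_bot (CPrv.init (C := ELLWc ∅) (A := .top) (by trivial) (by trivial))
  | top => exact swap (CPrv.top trivial (by simp [ELLWc]))
  | tensor B C hB hC =>
    simp only [CForm.hasVar, not_or] at hA
    have := tensor (swap (tensor_one (hB hA.1))) (swap (hC hA.2))
    rw [← Multiset.singleton_add, add_comm] at this
    simpa [trF, embBot, CForm.dual] using par (Γ := {_}) this
  | par B C hB hC =>
    simp only [CForm.hasVar, not_or] at hA
    have := tensor (hB hA.1) (tensor_one (hC hA.2))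
    rw [← Multiset.singleton_add, add_comm] at this
    simpa [trF, embBot, CForm.dual] using
      par_bot (swap (par (Γ := {_}) this))
  | and B C hB hC =>
    simp only [CForm.hasVar, not_or] at hA
    exact swap (CPrv.with' trivial (swap (CPrv.plus1 trivial (hB hA.1)))
      (swap (CPrv.plus2 trivial (hC hA.2))))
  | or B C hB hC =>
    simp only [CForm.hasVar, not_or] at hA
    have := par_bot (CPrv.with' (C := ELLWc ∅) trivial
      (swap (CPrv.plus1 trivial (swap (tensor_one (hB hA.1)))))
      (swap (CPrv.plus2 trivial (swap (tensor_one (hC hA.2))))))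
    simpa [trF, embBot, CForm.dual] using this
  | bang B hB =>
    have := par_bot (swap (funcF (swap (tensor_one (hB hA)))))
    simpa [trF, embBot, CForm.dual] using this
  | quest B hB => exact funcF (hB hA)

lemma of_embL_trF (S Δ : Multiset CForm) (hS : ∀ A ∈ S, ¬ A.hasVar x)
    (h : ELLW (embL x (S.map (trF (.var x))) + Δ)) : ELLW (S + Δ) := by
  induction S using Multiset.induction_on generalizing Δ with
  | empty => simpa using h
  | cons A S ih =>
    rw [embL, Multiset.map_cons, Multiset.map_cons, Multiset.cons_add] at h
    have := CPrv.cut (embBot_trF A (hS A (by simp))) h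
    rw [add_left_comm] at this
    simpa using ih _ (fun B hB => hS B (by simp [hB])) this

end Classical

/-- `⊢ Γ` is provable in ELLW iff `Γ^[x] ⊢ x` is provable in IELW,
for `x` a variable not occurring in `Γ`. -/
theorem ellw_iff_ielw_translation (Γ : Multiset CForm) (x : ℕ)
    (hx : ∀ A ∈ Γ, ¬ A.hasVar x) :
    CPrv (ELLWc ∅) Γ ↔
      IPrv (IELWc ∅) (Γ.map (trF (IForm.var x))) (some (IForm.var x)) := by
  constructor
  · intro h
    have := cut_map (trF (.var x)) (fun A => .neg x (dneg x A)) Γ (Γ := 0)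
      (fun A => IELW.neg_of_pair (by simp) (IELW.swap (trF_refutes_dneg A)))
      (by simpa using dneg_sound h)
    simpa using this
  · intro h
    have h1 := embBot_sound (x := x) h
    have h2 : ELLW (.bot ::ₘ embL x (Γ.map (trF (.var x)))) := by
      simpa [embBot] using h1
    have h3 := CPrv.cut (A := .bot) (Δ := 0) h2 (CPrv.one trivial)
    simpa using of_embL_trF Γ 0 hx h3
end Affine
end

section
/- Let !Γ,Δ ⊢ Π be a !-prenex {⊗,⊸,&,⊕,1,⊥}-sequent. If !Γ,Δ ⊢ Π is provable in ILZW, then there exists n ≥ 0 such that Γ^n,Δ ⊢ Π is provable in FLei. -/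
namespace Affine

open scoped Pointwise

/-- Provability in FLei relative to arbitrarily many copies of `Γ`. Contexts that contain a formula
outside the language of FLei count as inconsistent, so that left weakening holds for all formulas. -/
def FLeiFrom (Γ Δ : Multiset IForm) (X : Option IForm) : Prop :=
  (∀ A ∈ Δ, A.inFLei) → ∃ n : ℕ, IPrv (FLeic ∅) (n • Γ + Δ) X

theorem IPrv.weaken {C : ICalc} (hw : C.wL) {Γ Δ : Multiset IForm} {X : Option IForm}
    (hΔ : ∀ A ∈ Δ, C.K A) (h : IPrv C Γ X) : IPrv C (Δ + Γ) X := by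
  induction Δ using Multiset.induction with
  | empty => simpa using h
  | cons A Δ ih =>
    rw [Multiset.cons_add]
    exact .weakL hw (hΔ A (by simp)) (ih fun B hB => hΔ B (by simp [hB]))

theorem IPrv.mono_nsmul {Γ Δ : Multiset IForm} {X : Option IForm} {m n : ℕ}
    (hΓ : ∀ A ∈ Γ, A.inFLei) (hmn : m ≤ n) (h : IPrv (FLeic ∅) (m • Γ + Δ) X) :
    IPrv (FLeic ∅) (n • Γ + Δ) X := by
  obtain ⟨k, rfl⟩ := Nat.exists_eq_add_of_le hmn
  have := h.weaken (C := FLeic ∅) (Δ := k • Γ) trivial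
    fun A hA => hΓ A (Multiset.mem_of_mem_nsmul hA)
  rwa [← add_assoc, ← add_nsmul, add_comm k m] at this

namespace FLeiFrom

variable {Γ Δ Θ : Multiset IForm} {X : Option IForm} {A B : IForm}

theorem of_prv (h : IPrv (FLeic ∅) Δ X) : FLeiFrom Γ Δ X := fun _ => ⟨0, by simpa using h⟩

theorem weaken (Θ : Multiset IForm) (h : FLeiFrom Γ Δ X) : FLeiFrom Γ (Θ + Δ) X := by
  intro hK
  obtain ⟨n, hn⟩ := h fun A hA => hK A (by simp [hA])
  refine ⟨n, ?_⟩
  rw [add_left_comm]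
  exact hn.weaken (C := FLeic ∅) trivial fun A hA => hK A (by simp [hA])

theorem cut (hA : A.inFLei) (h₁ : FLeiFrom Γ Δ (some A)) (h₂ : FLeiFrom Γ (A ::ₘ Θ) X) :
    FLeiFrom Γ (Δ + Θ) X := by
  intro hK
  obtain ⟨m, hm⟩ := h₁ fun B hB => hK B (by simp [hB])
  obtain ⟨n, hn⟩ := h₂ (by
    simp only [Multiset.mem_cons, forall_eq_or_imp]
    exact ⟨hA, fun B hB => hK B (by simp [hB])⟩)
  rw [Multiset.add_cons] at hn
  refine ⟨m + n, ?_⟩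
  rw [add_nsmul, add_add_add_comm]
  exact .cut hm hn

theorem none_iff_bot : FLeiFrom Γ Δ none ↔ FLeiFrom Γ Δ (some .bot) := by
  constructor
  · intro h hK
    obtain ⟨n, hn⟩ := h hK
    exact ⟨n, .botR trivial hn⟩
  · intro h
    simpa using h.cut (A := .bot) (Θ := 0) trivial (of_prv (.botL trivial))

theorem limp_iff (hA : A.inFLei) (hB : B.inFLei) :
    FLeiFrom Γ Δ (some (.limp A B)) ↔
      ∀ Θ, FLeiFrom Γ Θ (some A) → FLeiFrom Γ (Θ + Δ) (some B) := by
  have hAB : (FLeic ∅).K (.limp A B) := ⟨hA, hB⟩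
  constructor
  · intro h Θ hΘ
    refine hΘ.cut hA ?_
    have hmp : IPrv (FLeic ∅) (.limp A B ::ₘ ({A} + 0)) (some B) :=
      .limpL hAB (.init hA) (.init hB)
    have := h.cut hAB (of_prv hmp)
    simpa [add_comm Δ] using this
  · intro h hK
    obtain ⟨n, hn⟩ := h {A} (of_prv (.init hA)) (by simpa using ⟨hA, hK⟩)
    refine ⟨n, .limpR hAB ?_⟩
    simpa using hn

theorem tensorR (hA : A.inFLei) (hB : B.inFLei) (h₁ : FLeiFrom Γ Δ (some A))
    (h₂ : FLeiFrom Γ Θ (some B)) : FLeiFrom Γ (Δ + Θ) (some (.tensor A B)) := by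
  intro hK
  obtain ⟨m, hm⟩ := h₁ fun C hC => hK C (by simp [hC])
  obtain ⟨n, hn⟩ := h₂ fun C hC => hK C (by simp [hC])
  refine ⟨m + n, ?_⟩
  rw [add_nsmul, add_add_add_comm]
  exact .tensorR ⟨hA, hB⟩ hm hn

theorem tensorL (hA : A.inFLei) (hB : B.inFLei) (h : FLeiFrom Γ (A ::ₘ B ::ₘ Δ) X) :
    FLeiFrom Γ (.tensor A B ::ₘ Δ) X := by
  intro hK
  simp only [Multiset.mem_cons, forall_eq_or_imp] at hK
  obtain ⟨n, hn⟩ := h (by simpa using ⟨hA, hB, hK.2⟩)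
  refine ⟨n, ?_⟩
  rw [Multiset.add_cons] at hn ⊢
  rw [Multiset.add_cons] at hn
  exact .tensorL ⟨hA, hB⟩ hn

theorem and_iff (hΓ : ∀ A ∈ Γ, A.inFLei) (hA : A.inFLei) (hB : B.inFLei) :
    FLeiFrom Γ Δ (some (.and A B)) ↔ FLeiFrom Γ Δ (some A) ∧ FLeiFrom Γ Δ (some B) := by
  have hAB : (FLeic ∅).K (.and A B) := ⟨hA, hB⟩
  constructor
  · intro h
    constructor
    · simpa using h.cut (Θ := 0) hAB (of_prv (.withL1 hAB (.init hA)))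
    · simpa using h.cut (Θ := 0) hAB (of_prv (.withL2 hAB (.init hB)))
  · rintro ⟨h₁, h₂⟩ hK
    obtain ⟨m, hm⟩ := h₁ hK
    obtain ⟨n, hn⟩ := h₂ hK
    exact ⟨max m n, .withR hAB (hm.mono_nsmul hΓ (le_max_left m n))
      (hn.mono_nsmul hΓ (le_max_right m n))⟩

theorem plusR1 (hA : A.inFLei) (hB : B.inFLei) (h : FLeiFrom Γ Δ (some A)) :
    FLeiFrom Γ Δ (some (.or A B)) := fun hK =>
  let ⟨n, hn⟩ := h hK
  ⟨n, .plusR1 ⟨hA, hB⟩ hn⟩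

theorem plusR2 (hA : A.inFLei) (hB : B.inFLei) (h : FLeiFrom Γ Δ (some B)) :
    FLeiFrom Γ Δ (some (.or A B)) := fun hK =>
  let ⟨n, hn⟩ := h hK
  ⟨n, .plusR2 ⟨hA, hB⟩ hn⟩

theorem plusL (hΓ : ∀ A ∈ Γ, A.inFLei) (hA : A.inFLei) (hB : B.inFLei)
    (h₁ : FLeiFrom Γ (A ::ₘ Δ) X) (h₂ : FLeiFrom Γ (B ::ₘ Δ) X) :
    FLeiFrom Γ (.or A B ::ₘ Δ) X := by
  intro hK
  simp only [Multiset.mem_cons, forall_eq_or_imp] at hK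
  obtain ⟨m, hm⟩ := h₁ (by simpa using ⟨hA, hK.2⟩)
  obtain ⟨n, hn⟩ := h₂ (by simpa using ⟨hB, hK.2⟩)
  have hm' := hm.mono_nsmul hΓ (le_max_left m n)
  have hn' := hn.mono_nsmul hΓ (le_max_right m n)
  refine ⟨max m n, ?_⟩
  rw [Multiset.add_cons] at hm' hn' ⊢
  exact .plusL ⟨hA, hB⟩ hm' hn'

end FLeiFrom

/-- The phase-space closure operator on sets of contexts determined by `FLeiFrom Γ`. -/
def phaseClosure (Γ : Multiset IForm) (S : Set (Multiset IForm)) : Set (Multiset IForm) :=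
  {Δ | ∀ Θ X, (∀ Δ' ∈ S, FLeiFrom Γ (Δ' + Θ) X) → FLeiFrom Γ (Δ + Θ) X}

/-- The sets of contexts that are closed under `phaseClosure`. -/
def IsFact (Γ : Multiset IForm) (S : Set (Multiset IForm)) : Prop :=
  phaseClosure Γ S ⊆ S

section Facts

variable {Γ : Multiset IForm} {S T R : Set (Multiset IForm)}

theorem subset_phaseClosure : S ⊆ phaseClosure Γ S := fun Δ hΔ _ _ h => h Δ hΔ

theorem phaseClosure_mono (h : S ⊆ T) : phaseClosure Γ S ⊆ phaseClosure Γ T :=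
  fun _ hΔ Θ X hT => hΔ Θ X fun Δ' hΔ' => hT Δ' (h hΔ')

theorem isFact_phaseClosure : IsFact Γ (phaseClosure Γ S) :=
  fun _ hΔ Θ X hS => hΔ Θ X fun _ hΔ' => hΔ' Θ X hS

theorem isFact_setOf_fleiFrom (X : Option IForm) : IsFact Γ {Δ | FLeiFrom Γ Δ X} := by
  intro Δ hΔ
  simpa using hΔ 0 X fun Δ' hΔ' => by simpa using hΔ'

theorem isFact_univ : IsFact Γ Set.univ := Set.subset_univ _

theorem IsFact.inter (hS : IsFact Γ S) (hT : IsFact Γ T) : IsFact Γ (S ∩ T) := fun _ hΔ =>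
  ⟨hS (phaseClosure_mono Set.inter_subset_left hΔ),
    hT (phaseClosure_mono Set.inter_subset_right hΔ)⟩

/-- Closure commutes with residuation: it suffices to check generators. -/
theorem IsFact.phaseClosure_add_subset (hT : IsFact Γ T) (h : S + R ⊆ T) :
    phaseClosure Γ S + R ⊆ T := by
  rintro _ ⟨Δ, hΔ, Ψ, hΨ, rfl⟩
  refine hT fun Θ X hX => ?_
  rw [add_assoc]
  refine hΔ (Ψ + Θ) X fun Δ' hΔ' => ?_
  rw [← add_assoc]
  exact hX _ (h (Set.add_mem_add hΔ' hΨ))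

theorem IsFact.residual (hT : IsFact Γ T) : IsFact Γ {Δ | ∀ Θ ∈ S, Θ + Δ ∈ T} := by
  intro Δ hΔ Θ hΘ
  rw [add_comm]
  refine hT.phaseClosure_add_subset (R := S) ?_ (Set.add_mem_add hΔ hΘ)
  rintro _ ⟨Δ', hΔ', Ψ, hΨ, rfl⟩
  simpa [add_comm] using hΔ' Ψ hΨ

theorem IsFact.add_mem (hT : IsFact Γ T) (Θ : Multiset IForm) {Δ : Multiset IForm} (hΔ : Δ ∈ T) :
    Θ + Δ ∈ T := by
  refine hT fun Ψ X hX => ?_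
  rw [add_assoc]
  exact (hX Δ hΔ).weaken Θ

end Facts

/-- The phase-space interpretation of formulas. The modality `!` is two-valued: `!A` is everything
if `A` holds in the empty context, and the least fact otherwise. -/
def phaseSem (Γ : Multiset IForm) : IForm → Set (Multiset IForm)
  | .var n => {Δ | FLeiFrom Γ Δ (some (.var n))}
  | .one => Set.univ
  | .top => Set.univ
  | .bot => {Δ | FLeiFrom Γ Δ none}
  | .zero => phaseClosure Γ ∅
  | .tensor A B => phaseClosure Γ (phaseSem Γ A + phaseSem Γ B)
  | .limp A B => {Δ | ∀ Θ ∈ phaseSem Γ A, Θ + Δ ∈ phaseSem Γ B}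
  | .and A B => phaseSem Γ A ∩ phaseSem Γ B
  | .or A B => phaseClosure Γ (phaseSem Γ A ∪ phaseSem Γ B)
  | .bang A => phaseClosure Γ {_Δ | 0 ∈ phaseSem Γ A}
  | .para _ => Set.univ

/-- The interpretation of a stoup: the empty stoup is interpreted as `⊥`. -/
def stoupSem (Γ : Multiset IForm) (X : Option IForm) : Set (Multiset IForm) :=
  phaseSem Γ (X.getD .bot)

section Soundness

variable {Γ : Multiset IForm}

theorem isFact_phaseSem (A : IForm) : IsFact Γ (phaseSem Γ A) := by
  induction A with
  | var n => exact isFact_setOf_fleiFrom _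
  | one => exact isFact_univ
  | top => exact isFact_univ
  | bot => exact isFact_setOf_fleiFrom _
  | zero => exact isFact_phaseClosure
  | tensor A B => exact isFact_phaseClosure
  | limp A B _ ihB => exact ihB.residual
  | and A B ihA ihB => exact ihA.inter ihB
  | or A B => exact isFact_phaseClosure
  | bang A => exact isFact_phaseClosure
  | para A => exact isFact_univ

theorem isFact_stoupSem (X : Option IForm) : IsFact Γ (stoupSem Γ X) := isFact_phaseSem _

theorem IsFact.add_subset {T : Set (Multiset IForm)} (hT : IsFact Γ T)
    (S : Set (Multiset IForm)) : S + T ⊆ T := by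
  rintro _ ⟨Δ, _, Θ, hΘ, rfl⟩
  exact hT.add_mem Δ hΘ

theorem zero_mem_phaseSem_bang {A : IForm} (h : 0 ∈ phaseSem Γ A) : 0 ∈ phaseSem Γ (.bang A) :=
  subset_phaseClosure h

/-- To prove an inclusion out of `!A`, one may assume that `A` holds in the empty context. -/
theorem phaseSem_bang_add_subset {A : IForm} {R T : Set (Multiset IForm)} (hT : IsFact Γ T)
    (h : 0 ∈ phaseSem Γ A → R ⊆ T) : phaseSem Γ (.bang A) + R ⊆ T := by
  refine hT.phaseClosure_add_subset ?_
  rintro _ ⟨Δ, hΔ, Θ, hΘ, rfl⟩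
  exact hT.add_mem Δ (h hΔ hΘ)

theorem subset_add_of_zero_mem {S R : Set (Multiset IForm)} (h : 0 ∈ S) : R ⊆ S + R :=
  fun Δ hΔ => ⟨0, h, Δ, hΔ, zero_add Δ⟩

theorem sum_bang_subset (Δ : Multiset IForm) {T : Set (Multiset IForm)} (hT : IsFact Γ T)
    (h : (∀ A ∈ Δ, 0 ∈ phaseSem Γ A) → 0 ∈ T) :
    ((Δ.map .bang).map (phaseSem Γ)).sum ⊆ T := by
  induction Δ using Multiset.induction with
  | empty => simpa using h
  | cons A Δ ih =>
    simp only [Multiset.map_cons, Multiset.sum_cons]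
    refine phaseSem_bang_add_subset hT fun hA => ih fun hΔ => h ?_
    simpa using ⟨hA, hΔ⟩

theorem zero_mem_sum_bang {Δ : Multiset IForm} (h : ∀ A ∈ Δ, 0 ∈ phaseSem Γ A) :
    0 ∈ ((Δ.map .bang).map (phaseSem Γ)).sum := by
  induction Δ using Multiset.induction with
  | empty => simp
  | cons A Δ ih =>
    simp only [Multiset.mem_cons, forall_eq_or_imp] at h
    simp only [Multiset.map_cons, Multiset.sum_cons]
    exact subset_add_of_zero_mem (zero_mem_phaseSem_bang h.1) (ih h.2)

/-- ILZW is sound for the phase-space interpretation. -/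
theorem IPrv.sum_phaseSem_subset {Δ : Multiset IForm} {X : Option IForm}
    (h : IPrv (ILZWc ∅) Δ X) : (Δ.map (phaseSem Γ)).sum ⊆ stoupSem Γ X := by
  induction h with
  | axiom' h => exact h.elim
  | init _ => simp [stoupSem]
  | oneR _ => exact Set.subset_univ _
  | botL _ => simp [stoupSem]
  | topR _ _ => exact Set.subset_univ _
  | zeroL _ _ _ =>
    simp only [Multiset.map_cons, Multiset.sum_cons]
    exact (isFact_stoupSem _).phaseClosure_add_subset (by simp)
  | cut _ _ ih₁ ih₂ =>
    simp only [Multiset.map_cons, Multiset.sum_cons, Multiset.map_add, Multiset.sum_add]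
      at ih₂ ⊢
    exact (Set.add_subset_add_right ih₁).trans ih₂
  | oneL _ _ ih =>
    simp only [Multiset.map_cons, Multiset.sum_cons]
    exact (Set.add_subset_add_left ih).trans ((isFact_stoupSem _).add_subset _)
  | botR _ _ ih => exact ih
  | @limpL Δ Θ X A B _ _ _ ih₁ ih₂ =>
    simp only [Multiset.map_cons, Multiset.sum_cons, Multiset.map_add, Multiset.sum_add]
      at ih₂ ⊢
    rw [← add_assoc]
    refine (Set.add_subset_add_right ?_).trans ih₂
    rintro _ ⟨Φ, hΦ, Ψ, hΨ, rfl⟩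
    simpa [add_comm] using hΦ Ψ (ih₁ hΨ)
  | limpR _ _ ih =>
    simp only [Multiset.map_cons, Multiset.sum_cons] at ih
    exact fun Φ hΦ Θ hΘ => ih (Set.add_mem_add hΘ hΦ)
  | tensorL _ _ ih =>
    simp only [Multiset.map_cons, Multiset.sum_cons, ← add_assoc] at ih ⊢
    exact (isFact_stoupSem _).phaseClosure_add_subset ih
  | tensorR _ _ _ ih₁ ih₂ =>
    simp only [Multiset.map_add, Multiset.sum_add]
    exact (Set.add_subset_add ih₁ ih₂).trans subset_phaseClosure
  | withL1 _ _ ih =>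
    simp only [Multiset.map_cons, Multiset.sum_cons] at ih ⊢
    exact (Set.add_subset_add_right Set.inter_subset_left).trans ih
  | withL2 _ _ ih =>
    simp only [Multiset.map_cons, Multiset.sum_cons] at ih ⊢
    exact (Set.add_subset_add_right Set.inter_subset_right).trans ih
  | withR _ _ _ ih₁ ih₂ => exact Set.subset_inter ih₁ ih₂
  | plusL _ _ _ ih₁ ih₂ =>
    simp only [Multiset.map_cons, Multiset.sum_cons] at ih₁ ih₂ ⊢
    refine (isFact_stoupSem _).phaseClosure_add_subset ?_
    rw [Set.union_add]
    exact Set.union_subset ih₁ ih₂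
  | plusR1 _ _ ih => exact (ih.trans Set.subset_union_left).trans subset_phaseClosure
  | plusR2 _ _ ih => exact (ih.trans Set.subset_union_right).trans subset_phaseClosure
  | bangD _ _ _ ih =>
    simp only [Multiset.map_cons, Multiset.sum_cons] at ih ⊢
    exact phaseSem_bang_add_subset (isFact_stoupSem _) fun hA =>
      (subset_add_of_zero_mem hA).trans ih
  | bangP _ _ _ _ ih =>
    exact sum_bang_subset _ (isFact_stoupSem _) fun hΔ =>
      zero_mem_phaseSem_bang (ih (zero_mem_sum_bang hΔ))
  | weakL _ _ _ ih =>
    simp only [Multiset.map_cons, Multiset.sum_cons]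
    exact (Set.add_subset_add_left ih).trans ((isFact_stoupSem _).add_subset _)
  | bangC _ _ ih =>
    simp only [Multiset.map_cons, Multiset.sum_cons] at ih ⊢
    exact phaseSem_bang_add_subset (isFact_stoupSem _) fun hA =>
      have h₀ := zero_mem_phaseSem_bang hA
      ((subset_add_of_zero_mem h₀).trans (subset_add_of_zero_mem h₀)).trans ih
  | bangF h => exact h.elim
  | bangW h => exact h.elim
  | weakR h => exact h.elim
  | lalBang h => exact h.elim
  | lalPara h => exact h.elim

end Soundness

/-- A formula of FLei is interpreted as the set of contexts that prove it. -/
theorem phaseSem_eq {Γ : Multiset IForm} (hΓ : ∀ A ∈ Γ, A.inFLei) {A : IForm} (hA : A.inFLei) :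
    phaseSem Γ A = {Δ | FLeiFrom Γ Δ (some A)} := by
  induction A with
  | var n => rfl
  | one =>
    refine (Set.eq_univ_of_forall fun Δ => ?_).symm
    simpa using FLeiFrom.weaken Δ (.of_prv (Γ := Γ) (.oneR trivial))
  | bot =>
    ext Δ
    exact FLeiFrom.none_iff_bot
  | tensor A B ihA ihB =>
    rw [phaseSem, ihA hA.1, ihB hA.2]
    apply Set.Subset.antisymm
    · refine (phaseClosure_mono ?_).trans (isFact_setOf_fleiFrom _)
      rintro _ ⟨Δ, hΔ, Θ, hΘ, rfl⟩
      exact .tensorR hA.1 hA.2 hΔ hΘ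
    · intro Δ hΔ Θ X h
      have := h ({A} + {B}) (Set.add_mem_add (.of_prv (.init hA.1)) (.of_prv (.init hA.2)))
      exact FLeiFrom.cut hA hΔ (.tensorL hA.1 hA.2 (by simpa [add_assoc] using this))
  | limp A B ihA ihB =>
    rw [phaseSem, ihA hA.1, ihB hA.2]
    ext Δ
    exact (FLeiFrom.limp_iff hA.1 hA.2).symm
  | and A B ihA ihB =>
    rw [phaseSem, ihA hA.1, ihB hA.2]
    ext Δ
    exact (FLeiFrom.and_iff hΓ hA.1 hA.2).symm
  | or A B ihA ihB =>
    rw [phaseSem, ihA hA.1, ihB hA.2]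
    apply Set.Subset.antisymm
    · refine (phaseClosure_mono ?_).trans (isFact_setOf_fleiFrom _)
      rintro Δ (hΔ | hΔ)
      · exact .plusR1 hA.1 hA.2 hΔ
      · exact .plusR2 hA.1 hA.2 hΔ
    · intro Δ hΔ Θ X h
      have h₁ := h {A} (.inl (.of_prv (.init hA.1)))
      have h₂ := h {B} (.inr (.of_prv (.init hA.2)))
      exact FLeiFrom.cut hA hΔ (.plusL hΓ hA.1 hA.2 h₁ h₂)
  | top => exact hA.elim
  | zero => exact hA.elim
  | bang A => exact hA.elim
  | para A => exact hA.elim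

theorem mem_sum_phaseSem {Γ Δ : Multiset IForm} (hΓ : ∀ A ∈ Γ, A.inFLei)
    (hΔ : ∀ A ∈ Δ, A.inFLei) : Δ ∈ (Δ.map (phaseSem Γ)).sum := by
  induction Δ using Multiset.induction with
  | empty => simp
  | cons A Δ ih =>
    simp only [Multiset.mem_cons, forall_eq_or_imp] at hΔ
    rw [Multiset.map_cons, Multiset.sum_cons, ← Multiset.singleton_add]
    refine Set.add_mem_add ?_ (ih hΔ.2)
    rw [phaseSem_eq hΓ hΔ.1]
    exact .of_prv (.init hΔ.1)

theorem zero_mem_phaseSem_of_mem {Γ : Multiset IForm} (hΓ : ∀ A ∈ Γ, A.inFLei) {A : IForm}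
    (hA : A ∈ Γ) : 0 ∈ phaseSem Γ A := by
  rw [phaseSem_eq hΓ (hΓ A hA)]
  intro _
  obtain ⟨Δ, rfl⟩ := Multiset.exists_cons_of_mem hA
  refine ⟨1, ?_⟩
  have := IPrv.weaken (C := FLeic ∅) (Δ := Δ) trivial (fun B hB => hΓ B (by simp [hB]))
    (.init (hΓ A hA))
  simpa [add_comm Δ] using this

/-- If the !-prenex {⊗,⊸,&,⊕,1,⊥}-sequent `!Γ,Δ ⊢ X` is provable in ILZW,
then `Γ^n,Δ ⊢ X` is provable in FLei for some `n ≥ 0`. -/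
theorem ilzw_prenex_to_flei (Γ Δ : Multiset IForm) (X : Option IForm)
    (hΓ : ∀ A ∈ Γ, A.inFLei) (hΔ : ∀ A ∈ Δ, A.inFLei)
    (hX : ∀ A, X = some A → A.inFLei)
    (h : IPrv (ILZWc ∅) (Γ.map IForm.bang + Δ) X) :
    ∃ n : ℕ, IPrv (FLeic ∅) (n • Γ + Δ) X := by
  have hmem : Δ ∈ stoupSem Γ X := h.sum_phaseSem_subset <| by
    rw [Multiset.map_add, Multiset.sum_add]
    exact subset_add_of_zero_mem (zero_mem_sum_bang fun _ => zero_mem_phaseSem_of_mem hΓ)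
      (mem_sum_phaseSem hΓ hΔ)
  cases X with
  | none => exact hmem hΔ
  | some A =>
    rw [stoupSem, Option.getD_some, phaseSem_eq hΓ (hX A rfl)] at hmem
    exact hmem hΔ
end Affine
end
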